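/- arXiv:1207.1460 — 2 statements merged into one kernel-verified Lean document; each statement's English description precedes it below -/
import Mathlib

section
/- Let α ≥ 1, β ≥ 1 and m ≥ 1 be integers, let n ≥ 1, let S_n have the Pólya–Eggenberger urn mass function p(k) = C(n,k) (α/m)_k (β/m)_{n−k} / (α/m + β/m)_n on {0,1,…,n}, set W_n = S_n/n, and let Z have the Beta distribution B(α/m, β/m). Then d_W(W_n, Z) ≤ ( (m + max(α,β))/(2nm) + αβ/(nm(α+β)) ) (b₀ + b₁) + 3/(2n), where b₀ = b₀(α/m, β/m) and b₁ = b₁(α/m, β/m) are the explicit constants given in the context. -/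
open MeasureTheory

/-- The rising factorial `(x)_k = x (x+1) ⋯ (x+k-1)`, with `(x)_0 = 1`. -/
noncomputable def risingFac (x : ℝ) : ℕ → ℝ
  | 0 => 1
  | k + 1 => risingFac x k * (x + k)

/-- The Pólya–Eggenberger urn mass function
`p n k = C(n,k) (α/m)_k (β/m)_{n-k} / (α/m + β/m)_n` on `{0,1,…,n}`. -/
noncomputable def urnPmf (α β m n k : ℕ) : ℝ :=
  (n.choose k : ℝ) * risingFac ((α : ℝ) / m) k * risingFac ((β : ℝ) / m) (n - k)
    / risingFac ((α : ℝ) / m + (β : ℝ) / m) n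

/-- Expectation `E h(Z)` for `Z ∼ B(a,b)`, the Beta distribution with density
`x^{a-1} (1-x)^{b-1} / B(a,b)` on `[0,1]`, where `B(a,b) = Γ(a)Γ(b)/Γ(a+b)`. -/
noncomputable def betaExp (a b : ℝ) (h : ℝ → ℝ) : ℝ :=
  ∫ x in Set.Ioo (0 : ℝ) 1,
    (Real.Gamma (a + b) / (Real.Gamma a * Real.Gamma b))
      * x ^ (a - 1) * (1 - x) ^ (b - 1) * h x

/-- The constant `b₀(a,b)` of Lemma 3.3 (Lemma `lem:allbounds`). -/
noncomputable def b₀ (a b : ℝ) : ℝ :=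
  if a ≤ 2 then
    (if b ≤ 2 then 4 * max |a - 1| |b - 1|
     else (a + b - 2) ^ 2 * max (|a - 1| / a ^ 2) ((b - 1) / (b - 2) ^ 2))
  else
    (if b ≤ 2 then (a + b - 2) ^ 2 * max ((a - 1) / (a - 2) ^ 2) (|b - 1| / b ^ 2)
     else (a + b - 2) ^ 2 * max (1 / (a - 1)) (1 / (b - 1)))

/-- The constant `b₁(a,b)` of Lemma 3.3 (Lemma `lem:allbounds`). -/
noncomputable def b₁ (a b : ℝ) : ℝ :=
  if a ≤ 2 then
    (if b ≤ 2 then 4 * (1 + max a b / (a + b))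
     else (a + b - 2) ^ 2 / min a (b - 2) ^ 2 + 2 * max 1 (b / (b - 2)))
  else
    (if b ≤ 2 then (a + b - 2) ^ 2 / min (a - 2) b ^ 2 + 2 * max (a / (a - 2)) 1
     else (a + b - 2) ^ 2 / min (a - 1) (b - 1) ^ 2
            + 2 * max (a / (a - 1)) (b / (b - 1)))

open Set

section Calculus

/-- A function whose derivative is dominated by that of `Φ` has increments dominated by
those of `Φ`. -/
theorem abs_sub_le_sub_of_abs_deriv_le {u u' Φ Φ' : ℝ → ℝ} {x y : ℝ} (hxy : x ≤ y)
    (hu : ContinuousOn u (Icc x y)) (hu' : ∀ t ∈ Ioo x y, HasDerivAt u (u' t) t)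
    (hΦ : ContinuousOn Φ (Icc x y)) (hΦ' : ∀ t ∈ Ioo x y, HasDerivAt Φ (Φ' t) t)
    (hle : ∀ t ∈ Ioo x y, |u' t| ≤ Φ' t) : |u y - u x| ≤ Φ y - Φ x := by
  rcases hxy.eq_or_lt with rfl | hlt
  · simp
  have hpos : 0 < y - x := sub_pos.2 hlt
  obtain ⟨c, hc, hc'⟩ := exists_hasDerivAt_eq_slope (fun t => Φ t - u t)
    (fun t => Φ' t - u' t) hlt (hΦ.sub hu) (fun t ht => (hΦ' t ht).sub (hu' t ht))
  obtain ⟨d, hd, hd'⟩ := exists_hasDerivAt_eq_slope (fun t => Φ t + u t)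
    (fun t => Φ' t + u' t) hlt (hΦ.add hu) (fun t ht => (hΦ' t ht).add (hu' t ht))
  have h1 := (abs_le.1 (hle c hc)).2
  have h2 := (abs_le.1 (hle d hd)).1
  rw [eq_div_iff hpos.ne'] at hc' hd'
  have h3 : 0 ≤ (Φ' c - u' c) * (y - x) := mul_nonneg (by linarith) hpos.le
  have h4 : 0 ≤ (Φ' d + u' d) * (y - x) := mul_nonneg (by linarith) hpos.le
  rw [abs_le]
  constructor <;> linarith

theorem le_of_deriv_nonneg_Ioo {v v' : ℝ → ℝ} {x y : ℝ} (hxy : x ≤ y)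
    (hv : ContinuousOn v (Icc x y)) (hv' : ∀ t ∈ Ioo x y, HasDerivAt v (v' t) t)
    (hnn : ∀ t ∈ Ioo x y, 0 ≤ v' t) : v x ≤ v y := by
  have := abs_sub_le_sub_of_abs_deriv_le hxy hv hv' hv hv'
    (fun t ht => (abs_of_nonneg (hnn t ht)).le)
  linarith [abs_nonneg (v y - v x)]

end Calculus

section WeightedBounds

variable {a b : ℝ} {u u' : ℝ → ℝ}

theorem hasDerivAt_rpow_mul_one_sub_rpow (a b : ℝ) {x : ℝ} (hx : x ∈ Ioo (0 : ℝ) 1) :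
    HasDerivAt (fun t : ℝ => t ^ a * (1 - t) ^ b)
      (x ^ (a - 1) * (1 - x) ^ (b - 1) * (a - (a + b) * x)) x := by
  have h1 : HasDerivAt (fun t : ℝ => t ^ a) (a * x ^ (a - 1)) x :=
    Real.hasDerivAt_rpow_const (Or.inl hx.1.ne')
  have h2 : HasDerivAt (fun t : ℝ => (1 - t) ^ b) (-1 * b * (1 - x) ^ (b - 1)) x :=
    ((hasDerivAt_id x).const_sub 1).rpow_const (Or.inl (sub_pos.2 hx.2).ne')
  refine (h1.mul h2).congr_deriv ?_
  have e1 : x ^ a = x ^ (a - 1) * x := by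
    rw [← Real.rpow_add_one hx.1.ne']; congr 1; ring
  have e2 : (1 - x) ^ b = (1 - x) ^ (b - 1) * (1 - x) := by
    rw [← Real.rpow_add_one (sub_pos.2 hx.2).ne']; congr 1; ring
  rw [e1, e2]; ring

theorem continuous_rpow_mul_one_sub_rpow (ha : 0 ≤ a) (hb : 0 ≤ b) :
    Continuous (fun t : ℝ => t ^ a * (1 - t) ^ b) :=
  (Real.continuous_rpow_const ha).mul
    ((Real.continuous_rpow_const hb).comp (continuous_const.sub continuous_id))

/-- Up to the mode `a / (a + b)`, the weight `t ^ a * (1 - t) ^ b` is largest at the right end. -/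
theorem abs_le_of_le_mode (ha : 0 < a) (hb : 0 < b)
    (hu : ContinuousOn u (Icc 0 1)) (hu' : ∀ t ∈ Ioo (0 : ℝ) 1, HasDerivAt u (u' t) t)
    (hle : ∀ t ∈ Ioo (0 : ℝ) 1, |u' t| ≤ 2 * (t ^ a * (1 - t) ^ b)) (h0 : u 0 = 0)
    {x : ℝ} (hx : x ∈ Ioo (0 : ℝ) 1) (hmode : (a + b) * x ≤ a) :
    |u x| ≤ 2 * ((a + b) / b) * (x ^ (a + 1) * (1 - x) ^ (b + 1)) := by
  have hsub : Ioo 0 x ⊆ Ioo (0 : ℝ) 1 := fun t ht => ⟨ht.1, ht.2.trans hx.2⟩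
  have hΦ : ∀ t : ℝ, HasDerivAt (fun s : ℝ => 2 * (x ^ a * (1 - x) ^ b) * s)
      (2 * (x ^ a * (1 - x) ^ b)) t := fun t => by
    simpa using (hasDerivAt_id t).const_mul (2 * (x ^ a * (1 - x) ^ b))
  have key := abs_sub_le_sub_of_abs_deriv_le hx.1.le
    (hu.mono (Icc_subset_Icc_right hx.2.le)) (fun t ht => hu' t (hsub ht))
    (fun t _ => (hΦ t).continuousAt.continuousWithinAt) (fun t _ => hΦ t) (fun t ht => by
      refine (hle t (hsub ht)).trans ?_
      refine mul_le_mul_of_nonneg_left ?_ zero_le_two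
      refine le_of_deriv_nonneg_Ioo ht.2.le
        (continuous_rpow_mul_one_sub_rpow ha.le hb.le).continuousOn
        (fun s hs => hasDerivAt_rpow_mul_one_sub_rpow a b (hsub ⟨ht.1.trans hs.1, hs.2⟩))
        (fun s hs => ?_)
      have hs0 : 0 < s := ht.1.trans hs.1
      have hs1 : 0 < 1 - s := by linarith [hs.2, hx.2]
      refine mul_nonneg (by positivity) ?_
      nlinarith [hs.2])
  rw [h0, sub_zero, mul_zero, sub_zero] at key
  refine key.trans ?_
  have hx1 : 0 < 1 - x := sub_pos.2 hx.2
  rw [Real.rpow_add_one hx.1.ne', Real.rpow_add_one hx1.ne']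
  have hx0 := hx.1
  have h1 : 1 ≤ (a + b) / b * (1 - x) := by
    rw [div_mul_eq_mul_div, le_div_iff₀ hb]; linarith
  calc 2 * (x ^ a * (1 - x) ^ b) * x = 2 * (x ^ a * (1 - x) ^ b) * x * 1 := by ring
    _ ≤ 2 * (x ^ a * (1 - x) ^ b) * x * ((a + b) / b * (1 - x)) := by gcongr
    _ = _ := by ring

/-- Reflection `t ↦ 1 - t` of the data in the weighted bounds. -/
theorem reflect_deriv_bound (hu : ContinuousOn u (Icc 0 1))
    (hu' : ∀ t ∈ Ioo (0 : ℝ) 1, HasDerivAt u (u' t) t)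
    (hle : ∀ t ∈ Ioo (0 : ℝ) 1, |u' t| ≤ 2 * (t ^ a * (1 - t) ^ b)) :
    ContinuousOn (fun t => u (1 - t)) (Icc 0 1) ∧
    (∀ t ∈ Ioo (0 : ℝ) 1, HasDerivAt (fun t => u (1 - t)) (-u' (1 - t)) t) ∧
    ∀ t ∈ Ioo (0 : ℝ) 1, |-u' (1 - t)| ≤ 2 * (t ^ b * (1 - t) ^ a) := by
  have hmem : ∀ t ∈ Ioo (0 : ℝ) 1, 1 - t ∈ Ioo (0 : ℝ) 1 := fun t ht =>
    ⟨by linarith [ht.2], by linarith [ht.1]⟩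
  refine ⟨hu.comp (continuous_const.sub continuous_id).continuousOn
    (fun t ht => ⟨by linarith [ht.2], by linarith [ht.1]⟩), fun t ht => ?_, fun t ht => ?_⟩
  · simpa [Function.comp_def] using
      (hu' _ (hmem t ht)).comp t ((hasDerivAt_id t).const_sub 1)
  · rw [abs_neg]
    have := hle _ (hmem t ht)
    rw [sub_sub_cancel] at this
    linarith

theorem abs_le_two_mul_div_min (ha : 0 < a) (hb : 0 < b)
    (hu : ContinuousOn u (Icc 0 1)) (hu' : ∀ t ∈ Ioo (0 : ℝ) 1, HasDerivAt u (u' t) t)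
    (hle : ∀ t ∈ Ioo (0 : ℝ) 1, |u' t| ≤ 2 * (t ^ a * (1 - t) ^ b))
    (h0 : u 0 = 0) (h1 : u 1 = 0) {x : ℝ} (hx : x ∈ Ioo (0 : ℝ) 1) :
    |u x| ≤ 2 * ((a + b) / min a b) * (x ^ (a + 1) * (1 - x) ^ (b + 1)) := by
  have hx0 := hx.1
  have hx1 : 0 < 1 - x := sub_pos.2 hx.2
  have hmin : 0 < min a b := lt_min ha hb
  rcases le_total ((a + b) * x) a with hm | hm
  · refine (abs_le_of_le_mode ha hb hu hu' hle h0 hx hm).trans ?_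
    gcongr
    exact min_le_right _ _
  · obtain ⟨hv, hv', hvle⟩ := reflect_deriv_bound hu hu' hle
    have := abs_le_of_le_mode hb ha hv hv' hvle (by simpa using h1) (x := 1 - x)
      ⟨hx1, by linarith⟩ (by linarith)
    rw [sub_sub_cancel] at this
    refine this.trans ?_
    rw [mul_comm ((1 - x) ^ (b + 1)), add_comm b a]
    gcongr
    exact min_le_left _ _

theorem abs_le_six_of_left_le_one (ha : 0 < a) (ha1 : a ≤ 1) (hb : 0 < b)
    (hu : ContinuousOn u (Icc 0 1)) (hu' : ∀ t ∈ Ioo (0 : ℝ) 1, HasDerivAt u (u' t) t)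
    (hle : ∀ t ∈ Ioo (0 : ℝ) 1, |u' t| ≤ 2 * (t ^ a * (1 - t) ^ b))
    (h0 : u 0 = 0) (h1 : u 1 = 0) {x : ℝ} (hx : x ∈ Ioo (0 : ℝ) 1) :
    |u x| ≤ 6 * (x ^ (a + 1) * (1 - x) ^ (b + 1)) := by
  have hx0 := hx.1
  have hx1 : 0 < 1 - x := sub_pos.2 hx.2
  rcases le_total ((b + 2) * x) 1 with hm | hm
  · have hsub : Ioo 0 x ⊆ Ioo (0 : ℝ) 1 := fun t ht => ⟨ht.1, ht.2.trans hx.2⟩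
    have key := abs_sub_le_sub_of_abs_deriv_le (Φ := fun t : ℝ => 2 * t ^ (a + 1))
      (Φ' := fun t : ℝ => 2 * ((a + 1) * t ^ (a + 1 - 1))) hx.1.le
      (hu.mono (Icc_subset_Icc_right hx.2.le)) (fun t ht => hu' t (hsub ht))
      (((Real.continuous_rpow_const (by linarith)).const_mul 2).continuousOn)
      (fun t ht => (Real.hasDerivAt_rpow_const (Or.inl ht.1.ne')).const_mul 2)
      (fun t ht => by
        have ht0 := ht.1
        have ht1 : 0 ≤ 1 - t := by linarith [ht.2]
        have hb1 : (1 - t) ^ b ≤ 1 := Real.rpow_le_one ht1 (by linarith) hb.le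
        have hta : 0 < t ^ a := Real.rpow_pos_of_pos ht0 a
        refine (hle t (hsub ht)).trans ?_
        rw [add_sub_cancel_right]
        nlinarith)
    rw [h0, sub_zero, Real.zero_rpow (by linarith), mul_zero, sub_zero] at key
    refine key.trans ?_
    have hpow : 1 / 3 ≤ (1 - x) ^ (b + 1) := by
      have hlog : -1 ≤ Real.log (1 - x) * (b + 1) := by
        have h2 := Real.one_sub_inv_le_log_of_pos hx1
        have h3 : -1 ≤ (1 - (1 - x)⁻¹) * (b + 1) := by
          have : (1 - (1 - x)⁻¹) = -x / (1 - x) := by field_simp; ring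
          rw [this, div_mul_eq_mul_div, le_div_iff₀ hx1]
          linarith
        exact h3.trans (by gcongr)
      rw [Real.rpow_def_of_pos hx1]
      refine le_trans ?_ (Real.exp_le_exp.2 hlog)
      rw [Real.exp_neg, one_div]
      exact inv_anti₀ (Real.exp_pos 1) (by linarith [Real.exp_one_lt_d9])
    have hxa : 0 < x ^ (a + 1) := Real.rpow_pos_of_pos hx0 _
    nlinarith
  · have hsub : Ioo x 1 ⊆ Ioo (0 : ℝ) 1 := fun t ht => ⟨hx.1.trans ht.1, ht.2⟩
    have hd : ∀ (c t : ℝ), t < 1 → HasDerivAt (fun s : ℝ => (1 - s) ^ c)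
        (-1 * c * (1 - t) ^ (c - 1)) t := fun c t ht =>
      ((hasDerivAt_id t).const_sub 1).rpow_const (Or.inl (sub_pos.2 ht).ne')
    have hc : ∀ c : ℝ, 0 ≤ c → Continuous (fun s : ℝ => (1 - s) ^ c) := fun c hc =>
      (Real.continuous_rpow_const hc).comp (continuous_const.sub continuous_id)
    have key := abs_sub_le_sub_of_abs_deriv_le
      (Φ := fun t : ℝ => 2 * x ^ (a - 1) *
        ((1 - t) ^ (b + 2) / (b + 2) - (1 - t) ^ (b + 1) / (b + 1)))
      (Φ' := fun t : ℝ => 2 * x ^ (a - 1) *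
        (-1 * (b + 2) * (1 - t) ^ (b + 2 - 1) / (b + 2)
          - -1 * (b + 1) * (1 - t) ^ (b + 1 - 1) / (b + 1))) hx.2.le
      (hu.mono (Icc_subset_Icc_left hx.1.le)) (fun t ht => hu' t (hsub ht))
      (((((hc _ (by linarith)).div_const _).sub
        ((hc _ (by linarith)).div_const _)).const_mul _).continuousOn)
      (fun t ht => ((((hd _ t ht.2).div_const _).sub
        ((hd _ t ht.2).div_const _)).const_mul _))
      (fun t ht => by
        have ht0 := (hsub ht).1
        have ht1 : 0 < 1 - t := by linarith [ht.2]
        have e1 : (1 - t) ^ (b + 2 - 1) = (1 - t) ^ b * (1 - t) := by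
          rw [← Real.rpow_add_one ht1.ne']; congr 1; ring
        have e2 : t ^ a = t ^ (a - 1) * t := by
          rw [← Real.rpow_add_one ht0.ne']; congr 1; ring
        have e3 : t ^ (a - 1) ≤ x ^ (a - 1) :=
          Real.rpow_le_rpow_of_nonpos hx0 ht.1.le (by linarith)
        refine (hle t (hsub ht)).trans ?_
        rw [add_sub_cancel_right, e1, e2]
        have e4 : -1 * (b + 2) * ((1 - t) ^ b * (1 - t)) / (b + 2)
          - -1 * (b + 1) * (1 - t) ^ b / (b + 1) = t * (1 - t) ^ b := by
          field_simp; ring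
        rw [e4]
        calc 2 * (t ^ (a - 1) * t * (1 - t) ^ b) ≤ 2 * (x ^ (a - 1) * t * (1 - t) ^ b) := by
              gcongr
          _ = _ := by ring)
    rw [h1, zero_sub, abs_neg, sub_self, Real.zero_rpow (by linarith),
      Real.zero_rpow (by linarith)] at key
    refine key.trans ?_
    have e1 : (1 - x) ^ (b + 2) = (1 - x) ^ (b + 1) * (1 - x) := by
      rw [← Real.rpow_add_one hx1.ne']; congr 1; ring
    have e2 : x ^ (a + 1) = x ^ (a - 1) * x ^ 2 := by
      rw [← Real.rpow_natCast, ← Real.rpow_add hx0]; congr 1; push_cast; ring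
    rw [e1, e2]
    have e3 : 1 / (b + 1) - (1 - x) / (b + 2) ≤ 3 * x ^ 2 := by
      rw [div_sub_div _ _ (by linarith) (by linarith), div_le_iff₀ (by positivity)]
      have : 0 ≤ (b + 1) * x * ((b + 2) * x - 1) :=
        mul_nonneg (by positivity) (by linarith)
      nlinarith
    have hp : 0 < x ^ (a - 1) * (1 - x) ^ (b + 1) := by positivity
    calc 2 * x ^ (a - 1) * (0 / (b + 2) - 0 / (b + 1)) - 2 * x ^ (a - 1) *
          ((1 - x) ^ (b + 1) * (1 - x) / (b + 2) - (1 - x) ^ (b + 1) / (b + 1))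
        = 2 * (x ^ (a - 1) * (1 - x) ^ (b + 1)) * (1 / (b + 1) - (1 - x) / (b + 2)) := by ring
      _ ≤ 2 * (x ^ (a - 1) * (1 - x) ^ (b + 1)) * (3 * x ^ 2) := by gcongr
      _ = _ := by ring

/-- A uniform bound on the derivative of the Stein solution for the Beta distribution. -/
noncomputable def steinDerivBound (a b : ℝ) : ℝ :=
  if a ≤ 1 ∨ b ≤ 1 then 6 else 2 * ((a + b) / min a b)

theorem steinDerivBound_nonneg (ha : 0 < a) (hb : 0 < b) : 0 ≤ steinDerivBound a b := by
  have : 0 < min a b := lt_min ha hb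
  unfold steinDerivBound
  split_ifs <;> positivity

theorem abs_le_steinDerivBound (ha : 0 < a) (hb : 0 < b)
    (hu : ContinuousOn u (Icc 0 1)) (hu' : ∀ t ∈ Ioo (0 : ℝ) 1, HasDerivAt u (u' t) t)
    (hle : ∀ t ∈ Ioo (0 : ℝ) 1, |u' t| ≤ 2 * (t ^ a * (1 - t) ^ b))
    (h0 : u 0 = 0) (h1 : u 1 = 0) {x : ℝ} (hx : x ∈ Ioo (0 : ℝ) 1) :
    |u x| ≤ steinDerivBound a b * (x ^ (a + 1) * (1 - x) ^ (b + 1)) := by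
  unfold steinDerivBound
  split_ifs with hab
  · rcases hab with ha1 | hb1
    · exact abs_le_six_of_left_le_one ha ha1 hb hu hu' hle h0 h1 hx
    · obtain ⟨hv, hv', hvle⟩ := reflect_deriv_bound hu hu' hle
      have := abs_le_six_of_left_le_one hb hb1 ha hv hv' hvle (by simpa using h1)
        (by simpa using h0) (x := 1 - x) ⟨by linarith [hx.2], by linarith [hx.1]⟩
      rwa [sub_sub_cancel, mul_comm ((1 - x) ^ (b + 1))] at this
  · exact abs_le_two_mul_div_min ha hb hu hu' hle h0 h1 hx

end WeightedBounds

section Constants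

variable {a b : ℝ}

theorem b₀_comm (a b : ℝ) : b₀ a b = b₀ b a := by
  unfold b₀
  rw [add_comm b a]
  split_ifs <;> rw [max_comm]

theorem b₁_comm (a b : ℝ) : b₁ a b = b₁ b a := by
  unfold b₁
  rw [add_comm b a]
  split_ifs
  · rw [max_comm]
  all_goals rw [max_comm, min_comm]

theorem b₀_nonneg (a b : ℝ) : 0 ≤ b₀ a b := by
  unfold b₀
  split_ifs with ha hb hb
  · exact mul_nonneg (by norm_num) (le_max_of_le_left (abs_nonneg _))
  · exact mul_nonneg (sq_nonneg _) (le_max_of_le_left (by positivity))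
  · exact mul_nonneg (sq_nonneg _) (le_max_of_le_right (by positivity))
  · exact mul_nonneg (sq_nonneg _) (le_max_of_le_left (one_div_nonneg.2 (by linarith)))

theorem four_le_sq_div_min_sq {x y : ℝ} (hx : 0 < x) (hy : 0 < y) :
    4 ≤ (x + y) ^ 2 / min x y ^ 2 := by
  have hm : 0 < min x y := lt_min hx hy
  rw [le_div_iff₀ (by positivity)]
  nlinarith [min_le_left x y, min_le_right x y]

theorem six_le_b₁ (ha : 0 < a) (hb : 0 < b) : 6 ≤ b₁ a b := by
  unfold b₁
  split_ifs with ha2 hb2 hb2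
  · have : 1 / 2 ≤ max a b / (a + b) := by
      rw [le_div_iff₀ (by positivity)]
      linarith [le_max_left a b, le_max_right a b]
    linarith
  · have h1 := four_le_sq_div_min_sq ha (sub_pos.2 (not_le.1 hb2))
    rw [← add_sub_assoc] at h1
    linarith [le_max_left 1 (b / (b - 2))]
  · have h1 := four_le_sq_div_min_sq (sub_pos.2 (not_le.1 ha2)) hb
    rw [show a - 2 + b = a + b - 2 by ring] at h1
    linarith [le_max_right (a / (a - 2)) 1]
  · have h1 := four_le_sq_div_min_sq (x := a - 1) (y := b - 1) (by linarith) (by linarith)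
    rw [show a - 1 + (b - 1) = a + b - 2 by ring] at h1
    have h2 : 1 ≤ a / (a - 1) := by rw [one_le_div (by linarith)]; linarith
    linarith [le_max_left (a / (a - 1)) (b / (b - 1))]

theorem two_mul_div_left_le (ha : 1 < a) (hab : a ≤ b) :
    2 * ((a + b) / a) ≤ b₀ a b + b₁ a b := by
  have ha0 : 0 < a := by linarith
  by_cases ha2 : a ≤ 2
  · by_cases hb2 : b ≤ 2
    · refine le_trans ?_ (add_le_add (b₀_nonneg a b) (six_le_b₁ ha0 (by linarith)))
      have : (a + b) / a ≤ 3 := by rw [div_le_iff₀ ha0]; linarith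
      linarith
    · have hc : 0 < b - 2 := by linarith
      have hm : 0 < min a (b - 2) := lt_min ha0 hc
      simp only [b₀, b₁, if_pos ha2, if_neg hb2]
      have h0 : b - 1 ≤ (a + b - 2) ^ 2 * max (|a - 1| / a ^ 2) ((b - 1) / (b - 2) ^ 2) := by
        refine le_trans ?_ (mul_le_mul_of_nonneg_left (le_max_right _ _) (sq_nonneg _))
        rw [← mul_div_assoc, le_div_iff₀ (by positivity), mul_comm]
        exact mul_le_mul_of_nonneg_right (by nlinarith) (by linarith)
      have h1 : (1 + (b - 2) / a) ^ 2 ≤ (a + b - 2) ^ 2 / min a (b - 2) ^ 2 := by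
        rw [show 1 + (b - 2) / a = (a + b - 2) / a by field_simp; ring, div_pow]
        gcongr
        exact min_le_left _ _
      have h2 : b / (b - 2) = 1 + 2 / (b - 2) := by field_simp; ring
      have h3 : (a + b) / a = 1 + (b - 2) / a + 2 / a := by field_simp; ring
      have h4 : 2 / a ≤ 2 := by rw [div_le_iff₀ ha0]; linarith
      have h5 : 4 ≤ (b - 2) + 2 * (2 / (b - 2)) := by
        have : b - 2 + 2 * (2 / (b - 2)) - 4 = (b - 2 - 2) ^ 2 / (b - 2) := by field_simp; ring
        have : 0 ≤ (b - 2 - 2) ^ 2 / (b - 2) := by positivity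
        linarith
      have h6 := le_max_right 1 (b / (b - 2))
      nlinarith [sq_nonneg ((b - 2) / a)]
  · have hb2 : ¬ b ≤ 2 := by linarith
    have ha1 : 0 < a - 1 := by linarith
    refine le_trans ?_ (le_add_of_nonneg_left (b₀_nonneg a b))
    simp only [b₁, if_neg ha2, if_neg hb2]
    rw [min_eq_left (by linarith)]
    have h2 : 0 ≤ a / (a - 1) := by positivity
    have h3 := le_max_left (a / (a - 1)) (b / (b - 1))
    have h4 : 2 * ((a + b) / a) ≤ (a + b - 2) ^ 2 / (a - 1) ^ 2 := by
      have h5 : (a + b) / a ≤ (a + b - 2) / (a - 1) := by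
        rw [div_le_div_iff₀ ha0 ha1]; linarith
      have h6 : 2 ≤ (a + b - 2) / (a - 1) := by
        rw [le_div_iff₀ ha1]; linarith
      rw [← div_pow]
      nlinarith
    linarith

theorem steinDerivBound_le (ha : 0 < a) (hb : 0 < b) :
    steinDerivBound a b ≤ b₀ a b + b₁ a b := by
  unfold steinDerivBound
  split_ifs with h
  · linarith [b₀_nonneg a b, six_le_b₁ ha hb]
  · push Not at h
    rcases le_total a b with hab | hab
    · rw [min_eq_left hab]
      exact two_mul_div_left_le h.1 hab
    · rw [min_eq_right hab, add_comm a b, b₀_comm, b₁_comm]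
      exact two_mul_div_left_le h.2 hab

end Constants

section Urn

theorem risingFac_pos {x : ℝ} (hx : 0 < x) (k : ℕ) : 0 < risingFac x k := by
  induction k with
  | zero => simp [risingFac]
  | succ k ih => rw [risingFac]; positivity

/-- The Chu–Vandermonde identity for rising factorials. -/
theorem sum_choose_mul_risingFac (a b : ℝ) (n : ℕ) :
    ∑ k ∈ Finset.range (n + 1), (n.choose k : ℝ) * risingFac a k * risingFac b (n - k)
      = risingFac (a + b) n := by
  induction n with
  | zero => simp [risingFac]
  | succ n ih =>
    have := Finset.sum_choose_succ_mul (fun i j => risingFac a i * risingFac b j) n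
    simp only [mul_assoc]
    rw [this, risingFac, ← ih, Finset.sum_mul, ← Finset.sum_add_distrib]
    refine Finset.sum_congr rfl fun k hk => ?_
    have hk' : k ≤ n := Nat.lt_succ_iff.1 (Finset.mem_range.1 hk)
    rw [Nat.succ_sub hk', risingFac, risingFac, Nat.cast_sub hk']
    ring

variable {α β m : ℕ}

theorem urnPmf_nonneg (α β m n k : ℕ) (hα : 0 < α) (hβ : 0 < β) (hm : 0 < m) :
    0 ≤ urnPmf α β m n k := by
  have ha : 0 < (α : ℝ) / m := by positivity
  have hb : 0 < (β : ℝ) / m := by positivity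
  have h1 := risingFac_pos ha k
  have h2 := risingFac_pos hb (n - k)
  have h3 := risingFac_pos (add_pos ha hb) n
  unfold urnPmf
  positivity

theorem sum_urnPmf (n : ℕ) (hα : 0 < α) (hβ : 0 < β) (hm : 0 < m) :
    ∑ k ∈ Finset.range (n + 1), urnPmf α β m n k = 1 := by
  have ha : 0 < (α : ℝ) / m := by positivity
  have hb : 0 < (β : ℝ) / m := by positivity
  simp only [urnPmf]
  rw [← Finset.sum_div, sum_choose_mul_risingFac, div_self (risingFac_pos (add_pos ha hb) n).ne']

theorem urnPmf_succ {n k : ℕ} (hk : k < n) :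
    urnPmf α β m n (k + 1) * (((k + 1 : ℕ) : ℝ) * ((β : ℝ) / m + n - (k + 1 : ℕ)))
      = urnPmf α β m n k * (((α : ℝ) / m + k) * (n - k)) := by
  obtain ⟨j, rfl⟩ : ∃ j, n = k + 1 + j := ⟨n - (k + 1), by omega⟩
  have hc : (((k + 1 + j).choose (k + 1) : ℕ) : ℝ) * (k + 1)
      = ((k + 1 + j).choose k : ℕ) * (j + 1) := by
    have := Nat.choose_succ_right_eq (k + 1 + j) k
    rw [show k + 1 + j - k = j + 1 by omega] at this
    exact_mod_cast this
  have e1 : k + 1 + j - (k + 1) = j := by omega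
  have e2 : k + 1 + j - k = j + 1 := by omega
  unfold urnPmf
  rw [e1, e2, risingFac, risingFac]
  push_cast
  have : (β : ℝ) / m + ((k : ℝ) + 1 + j) - (k + 1) = (β : ℝ) / m + j := by ring
  rw [this, show (k : ℝ) + 1 + j - k = j + 1 by ring, div_mul_eq_mul_div, div_mul_eq_mul_div]
  congr 1
  linear_combination (risingFac ((α : ℝ) / m) k * ((α : ℝ) / m + k) * risingFac ((β : ℝ) / m) j
    * ((β : ℝ) / m + j)) * hc

/-- The Stein identity characterising the urn law. -/
theorem sum_urnPmf_stein (n : ℕ) (g : ℕ → ℝ) :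
    ∑ k ∈ Finset.range (n + 1), urnPmf α β m n k *
      (((α : ℝ) / m + k) * (n - k) * (g (k + 1) - g k)
        + ((α : ℝ) / m * n - ((α : ℝ) / m + (β : ℝ) / m) * k) * g k) = 0 := by
  have hsplit : ∀ k : ℕ, urnPmf α β m n k *
      (((α : ℝ) / m + k) * (n - k) * (g (k + 1) - g k)
        + ((α : ℝ) / m * n - ((α : ℝ) / m + (β : ℝ) / m) * k) * g k)
      = urnPmf α β m n k * (((α : ℝ) / m + k) * (n - k)) * g (k + 1)
        - urnPmf α β m n k * ((k : ℝ) * ((β : ℝ) / m + n - k)) * g k := fun k => by ring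
  simp only [hsplit, Finset.sum_sub_distrib]
  rw [Finset.sum_range_succ, Finset.sum_range_succ' (fun k => urnPmf α β m n k *
    ((k : ℝ) * ((β : ℝ) / m + n - k)) * g k)]
  rw [Finset.sum_congr rfl fun k hk => by rw [← urnPmf_succ (Finset.mem_range.1 hk)]]
  simp

theorem sum_urnPmf_mul_one_sub {n : ℕ} (hn : 0 < n) (hα : 0 < α) (hβ : 0 < β) (hm : 0 < m) :
    ∑ k ∈ Finset.range (n + 1), urnPmf α β m n k * (1 - (k : ℝ) / n)
      = ((β : ℝ) / m) / ((α : ℝ) / m + (β : ℝ) / m) := by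
  have ha : 0 < (α : ℝ) / m := by positivity
  have hb : 0 < (β : ℝ) / m := by positivity
  have h := sum_urnPmf_stein (α := α) (β := β) (m := m) n (fun _ => 1)
  have h1 := sum_urnPmf (α := α) (β := β) (m := m) n hα hβ hm
  have hn' : (0 : ℝ) < n := by positivity
  have e : ∀ k : ℕ, urnPmf α β m n k *
      (((α : ℝ) / m + k) * (n - k) * ((1 : ℝ) - 1)
        + ((α : ℝ) / m * n - ((α : ℝ) / m + (β : ℝ) / m) * k) * 1)
      = ((α : ℝ) / m + (β : ℝ) / m) * n * (urnPmf α β m n k * (1 - (k : ℝ) / n))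
        - (β : ℝ) / m * n * urnPmf α β m n k := fun k => by field_simp; ring
  simp only [e, Finset.sum_sub_distrib, ← Finset.mul_sum, h1] at h
  rw [eq_div_iff (by positivity)]
  apply mul_right_cancel₀ hn'.ne'
  linear_combination h

end Urn

section SteinEstimate

/-- `f`, with derivative `f'`, is a bounded Lipschitz solution on `[0, 1]` of the Stein equation
of the Beta distribution `B(a, b)` with right-hand side `H`. -/
structure IsBetaSteinSolution (a b C : ℝ) (H f f' : ℝ → ℝ) : Prop where
  continuousOn : ContinuousOn f (Icc 0 1)
  hasDerivAt : ∀ x ∈ Ioo (0 : ℝ) 1, HasDerivAt f (f' x) x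
  equation : ∀ x ∈ Ioo (0 : ℝ) 1, x * (1 - x) * f' x + (a - (a + b) * x) * f x = H x
  at_one : -b * f 1 = H 1
  abs_le : ∀ x ∈ Ioo (0 : ℝ) 1, |f x| ≤ 1 / (a + b)
  abs_deriv_le : ∀ x ∈ Ioo (0 : ℝ) 1, |f' x| ≤ C

variable {a b C : ℝ} {H f f' : ℝ → ℝ}

theorem IsBetaSteinSolution.abs_sub_le (hf : IsBetaSteinSolution a b C H f f')
    {x y : ℝ} (hx : 0 ≤ x) (hxy : x ≤ y) (hy : y ≤ 1) : |f y - f x| ≤ C * (y - x) := by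
  have hsub : Ioo x y ⊆ Ioo 0 1 := Ioo_subset_Ioo hx hy
  have hΦ : ∀ t : ℝ, HasDerivAt (fun s : ℝ => C * s) C t := fun t => by
    simpa using (hasDerivAt_id t).const_mul C
  have := abs_sub_le_sub_of_abs_deriv_le hxy (hf.continuousOn.mono (Icc_subset_Icc hx hy))
    (fun t ht => hf.hasDerivAt t (hsub ht))
    (fun t _ => (hΦ t).continuousAt.continuousWithinAt) (fun t _ => hΦ t)
    (fun t ht => hf.abs_deriv_le t (hsub ht))
  linarith

theorem IsBetaSteinSolution.abs_step_le (hf : IsBetaSteinSolution a b C H f f')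
    (ha : 0 < a) (hb : 0 < b) (hH : ∀ x y, |H x - H y| ≤ |x - y|)
    {x δ : ℝ} (hx : 0 ≤ x) (hδ : 0 ≤ δ) (hxδ : x + δ ≤ 1) :
    |δ * H x - x * (1 - x) * (f (x + δ) - f x) - δ * ((a - (a + b) * x) * f x)|
      ≤ (2 + (1 + max a b) * C) / 2 * δ ^ 2 := by
  have hmem : ∀ s ∈ Ioo 0 δ, x + s ∈ Ioo (0 : ℝ) 1 := fun s hs =>
    ⟨by linarith [hs.1], by linarith [hs.2]⟩
  have hab : 0 < a + b := by positivity
  have key := abs_sub_le_sub_of_abs_deriv_le (x := 0) (y := δ)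
    (u := fun s => s * H x - x * (1 - x) * (f (x + s) - f x) - s * ((a - (a + b) * x) * f x))
    (u' := fun s => H x - x * (1 - x) * f' (x + s) - (a - (a + b) * x) * f x)
    (Φ := fun s => (2 + (1 + max a b) * C) / 2 * s ^ 2)
    (Φ' := fun s => (2 + (1 + max a b) * C) * s) hδ
    (by
      have : ContinuousOn (fun s => f (x + s)) (Icc 0 δ) :=
        hf.continuousOn.comp (by fun_prop)
          (fun s hs => ⟨by linarith [hs.1], by linarith [hs.2]⟩)
      exact ((continuousOn_id.mul continuousOn_const).sub
        (continuousOn_const.mul (this.sub continuousOn_const))).sub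
        (continuousOn_id.mul continuousOn_const))
    (fun s hs => by
      have h1 := (hf.hasDerivAt _ (hmem s hs)).comp_const_add x s
      have h2 := (((hasDerivAt_id s).mul_const (H x)).sub
        ((h1.sub_const (f x)).const_mul (x * (1 - x)))).sub
        ((hasDerivAt_id s).mul_const ((a - (a + b) * x) * f x))
      exact h2.congr_deriv (by ring))
    (by fun_prop)
    (fun s _ => (((hasDerivAt_id s).pow 2).const_mul _).congr_deriv (by simp; ring))
    (fun s hs => by
      have hs0 := hs.1
      have ht := hmem s hs
      have heq := hf.equation _ ht
      have h1 : |H x - H (x + s)| ≤ s := by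
        refine (hH _ _).trans ?_
        rw [show x - (x + s) = -s by ring, abs_neg, abs_of_pos hs0]
      have h2 : |f (x + s) - f x| ≤ C * s := by
        simpa using hf.abs_sub_le hx (by linarith : x ≤ x + s) ht.2.le
      have h3 := hf.abs_le _ ht
      have h4 := hf.abs_deriv_le _ ht
      have h5 : |a - (a + b) * x| ≤ max a b := by
        rw [_root_.abs_le]
        have := le_max_left a b
        have := le_max_right a b
        have hx1 : x ≤ 1 := by linarith
        constructor <;> nlinarith
      have h6 : |1 - x - (x + s)| ≤ 1 := by
        rw [_root_.abs_le]; constructor <;> linarith [ht.2, ht.1]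
      have e : H x - x * (1 - x) * f' (x + s) - (a - (a + b) * x) * f x
          = (H x - H (x + s)) + (a - (a + b) * x) * (f (x + s) - f x)
            + (-((a + b) * s) * f (x + s)) + s * (1 - x - (x + s)) * f' (x + s) := by
        linear_combination -heq
      have hm0 : 0 ≤ max a b := le_max_of_le_left ha.le
      have b1 : |(a - (a + b) * x) * (f (x + s) - f x)| ≤ max a b * (C * s) := by
        rw [abs_mul]; gcongr
      have b2 : |-((a + b) * s) * f (x + s)| ≤ s := by
        rw [abs_mul, abs_neg, abs_of_pos (by positivity)]
        calc (a + b) * s * |f (x + s)| ≤ (a + b) * s * (1 / (a + b)) := by gcongr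
          _ = s := by field_simp
      have b3 : |s * (1 - x - (x + s)) * f' (x + s)| ≤ s * 1 * C := by
        rw [abs_mul, abs_mul, abs_of_pos hs0]; gcongr
      simp only [e]
      refine (abs_add_le _ _).trans ?_
      have := abs_add_three (H x - H (x + s)) ((a - (a + b) * x) * (f (x + s) - f x))
        (-((a + b) * s) * f (x + s))
      linarith)
  simpa using key

theorem IsBetaSteinSolution.abs_sum_urnPmf_le {α β m n : ℕ} (hα : 0 < α) (hβ : 0 < β) (hm : 0 < m)
    (hn : 0 < n) (hf : IsBetaSteinSolution ((α : ℝ) / m) ((β : ℝ) / m) C H f f')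
    (hC : 0 ≤ C) (hH : ∀ x y, |H x - H y| ≤ |x - y|) :
    |∑ k ∈ Finset.range (n + 1), urnPmf α β m n k * H ((k : ℝ) / n)|
      ≤ (((m : ℝ) + max (α : ℝ) (β : ℝ)) / (2 * n * m)
            + (α : ℝ) * (β : ℝ) / (n * m * ((α : ℝ) + (β : ℝ)))) * C + 1 / n := by
  have hmax : max ((α : ℝ) / m) ((β : ℝ) / m) = max (α : ℝ) β / m :=
    max_div_div_right (Nat.cast_nonneg m) _ _
  have hst := sum_urnPmf_stein (α := α) (β := β) (m := m) n (fun k => f ((k : ℝ) / n))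
  have hsum := sum_urnPmf (α := α) (β := β) (m := m) n hα hβ hm
  have hmean := sum_urnPmf_mul_one_sub (α := α) (β := β) (m := m) hn hα hβ hm
  have ha : 0 < (α : ℝ) / m := by positivity
  have hb : 0 < (β : ℝ) / m := by positivity
  have hn' : (0 : ℝ) < n := by positivity
  have hα' : (0 : ℝ) < α := by positivity
  have hβ' : (0 : ℝ) < β := by positivity
  have hm' : (0 : ℝ) < m := by positivity
  set a : ℝ := (α : ℝ) / m with ha_def
  set b : ℝ := (β : ℝ) / m with hb_def
  set K : ℝ := 2 + (1 + max a b) * C with hK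
  have hK0 : 0 ≤ K := by
    have : 0 ≤ max a b := le_max_of_le_left ha.le
    positivity
  have hterm : ∀ k ∈ Finset.range (n + 1),
      |H ((k : ℝ) / n) - ((a + k) * (n - k) * (f (((k + 1 : ℕ) : ℝ) / n) - f ((k : ℝ) / n))
        + (a * n - (a + b) * k) * f ((k : ℝ) / n)) / n|
      ≤ K / (2 * n) + a * C / n * (1 - (k : ℝ) / n) := by
    intro k hk
    have hkn : k ≤ n := Nat.lt_succ_iff.1 (Finset.mem_range.1 hk)
    rcases hkn.eq_or_lt with rfl | hlt
    · have h1 : (k : ℝ) / k = 1 := div_self hn'.ne'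
      rw [h1, ← hf.at_one]
      have : -b * f 1 - ((a + k) * (k - k) * (f (((k + 1 : ℕ) : ℝ) / k) - f 1)
          + (a * k - (a + b) * k) * f 1) / k = 0 := by field_simp; ring
      rw [this, abs_zero]
      simp only [sub_self, mul_zero, add_zero]
      positivity
    · set x : ℝ := (k : ℝ) / n with hx
      have hk1 : ((k : ℝ) + 1) ≤ n := by exact_mod_cast hlt
      have hx0 : 0 ≤ x := by positivity
      have hxe : ((k + 1 : ℕ) : ℝ) / n = x + 1 / n := by push_cast; rw [add_div]
      have hx1 : x + 1 / n ≤ 1 := by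
        rw [← hxe, div_le_one hn']; exact_mod_cast hlt
      have hδ : (0 : ℝ) ≤ 1 / n := by positivity
      have h1 := hf.abs_step_le ha hb hH hx0 hδ hx1
      have h2 := hf.abs_sub_le hx0 (by linarith : x ≤ x + 1 / n) hx1
      rw [add_sub_cancel_left] at h2
      rw [hxe]
      set Δ : ℝ := f (x + 1 / n) - f x
      have hkx : (k : ℝ) = n * x := by rw [hx]; field_simp
      have e : H x - ((a + k) * (n - k) * Δ + (a * n - (a + b) * k) * f x) / n
          = n * (1 / n * H x - x * (1 - x) * Δ - 1 / n * ((a - (a + b) * x) * f x))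
            + -(a * (1 - x) * Δ) := by
        rw [hkx]; field_simp; ring
      have h3 : 0 ≤ 1 - x := by linarith
      rw [e]
      refine (abs_add_le _ _).trans (add_le_add ?_ ?_)
      · rw [abs_mul, abs_of_pos hn']
        calc _ ≤ (n : ℝ) * (K / 2 * (1 / n) ^ 2) := by gcongr
          _ = K / (2 * n) := by field_simp
      · rw [abs_neg, abs_mul, abs_of_nonneg (by positivity)]
        calc _ ≤ a * (1 - x) * (C * (1 / n)) := by gcongr
          _ = _ := by ring
  have hrepr : ∑ k ∈ Finset.range (n + 1), urnPmf α β m n k * H ((k : ℝ) / n)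
      = ∑ k ∈ Finset.range (n + 1), urnPmf α β m n k * (H ((k : ℝ) / n)
        - ((a + k) * (n - k) * (f (((k + 1 : ℕ) : ℝ) / n) - f ((k : ℝ) / n))
        + (a * n - (a + b) * k) * f ((k : ℝ) / n)) / n) := by
    simp only [mul_sub, Finset.sum_sub_distrib, ← mul_div_assoc, ← Finset.sum_div]
    simp only [mul_sub] at hst
    rw [hst]; simp
  rw [hrepr]
  calc _ ≤ ∑ k ∈ Finset.range (n + 1), urnPmf α β m n k *
        (K / (2 * n) + a * C / n * (1 - (k : ℝ) / n)) := by
        refine (Finset.abs_sum_le_sum_abs _ _).trans (Finset.sum_le_sum fun k hk => ?_)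
        have hp := urnPmf_nonneg α β m n k hα hβ hm
        rw [abs_mul, abs_of_nonneg hp]
        exact mul_le_mul_of_nonneg_left (hterm k hk) hp
    _ = K / (2 * n) + a * C / n * (b / (a + b)) := by
        rw [← hmean]
        simp only [mul_add, Finset.sum_add_distrib, mul_left_comm _ (a * C / n),
          ← Finset.mul_sum, ← Finset.sum_mul, hsum, one_mul]
    _ = _ := by
        rw [hK, hmax, ha_def, hb_def]
        field_simp
        ring

end SteinEstimate

section SteinSolution

open Topology Filter

variable {a b : ℝ} {H H' I : ℝ → ℝ}

theorem primitive_le_of_lipschitz (ha : 0 < a) (hb : 0 < b)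
    (hI : ContinuousOn I (Icc 0 1))
    (hI' : ∀ t ∈ Ioo (0 : ℝ) 1, HasDerivAt I (t ^ (a - 1) * (1 - t) ^ (b - 1) * H t) t)
    (h0 : I 0 = 0) (h1 : I 1 = 0) (hH : ∀ x y, |H x - H y| ≤ |x - y|)
    {x : ℝ} (hx : x ∈ Icc (0 : ℝ) 1) : I x ≤ x ^ a * (1 - x) ^ b / (a + b) := by
  have hab : 0 < a + b := by positivity
  set v : ℝ → ℝ := fun t => t ^ a * (1 - t) ^ b / (a + b) - I t with hv_def
  have hv : ContinuousOn v (Icc 0 1) :=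
    ((continuous_rpow_mul_one_sub_rpow ha.le hb.le).div_const _).continuousOn.sub hI
  have hv' : ∀ t ∈ Ioo (0 : ℝ) 1, HasDerivAt v
      (t ^ (a - 1) * (1 - t) ^ (b - 1) * (a / (a + b) - (t + H t))) t := fun t ht =>
    (((hasDerivAt_rpow_mul_one_sub_rpow a b ht).div_const (a + b)).sub (hI' t ht)).congr_deriv
      (by field_simp; ring)
  have hmono : ∀ s t, s ≤ t → s + H s ≤ t + H t := fun s t hst => by
    have := (abs_le.1 (hH t s)).1
    rw [abs_of_nonneg (by linarith)] at this
    linarith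
  have hv0 : v 0 = 0 := by simp [hv_def, h0, Real.zero_rpow ha.ne']
  have hv1 : v 1 = 0 := by simp [hv_def, h1, Real.zero_rpow hb.ne']
  suffices 0 ≤ v x from sub_nonneg.1 this
  rcases le_total (x + H x) (a / (a + b)) with hle | hle
  · rw [← hv0]
    refine le_of_deriv_nonneg_Ioo hx.1 (hv.mono (Icc_subset_Icc_right hx.2))
      (fun t ht => hv' t ⟨ht.1, ht.2.trans_le hx.2⟩) (fun t ht => ?_)
    have ht0 := ht.1
    have ht1 : 0 < 1 - t := by linarith [ht.2, hx.2]
    exact mul_nonneg (by positivity) (by linarith [hmono t x ht.2.le])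
  · rw [← neg_nonpos, ← neg_zero, ← hv1]
    refine le_of_deriv_nonneg_Ioo (v := fun t => -v t) hx.2
      (hv.neg.mono (Icc_subset_Icc_left hx.1))
      (fun t ht => (hv' t ⟨hx.1.trans_lt ht.1, ht.2⟩).neg) (fun t ht => ?_)
    have ht0 : 0 < t := hx.1.trans_lt ht.1
    have ht1 : 0 < 1 - t := by linarith [ht.2]
    rw [← mul_neg]
    exact mul_nonneg (by positivity) (by linarith [hmono x t ht.1.le])

theorem abs_primitive_le_of_lipschitz (ha : 0 < a) (hb : 0 < b)
    (hI : ContinuousOn I (Icc 0 1))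
    (hI' : ∀ t ∈ Ioo (0 : ℝ) 1, HasDerivAt I (t ^ (a - 1) * (1 - t) ^ (b - 1) * H t) t)
    (h0 : I 0 = 0) (h1 : I 1 = 0) (hH : ∀ x y, |H x - H y| ≤ |x - y|)
    {x : ℝ} (hx : x ∈ Icc (0 : ℝ) 1) : |I x| ≤ x ^ a * (1 - x) ^ b / (a + b) := by
  refine abs_le'.2 ⟨primitive_le_of_lipschitz ha hb hI hI' h0 h1 hH hx, ?_⟩
  refine primitive_le_of_lipschitz (I := fun t => -I t) (H := fun t => -H t) ha hb hI.neg
    (fun t ht => (hI' t ht).neg.congr_deriv (by ring)) (by simp [h0]) (by simp [h1])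
    (fun s t => ?_) hx
  rw [neg_sub_neg, abs_sub_comm]
  exact hH s t

theorem abs_sub_le_of_abs_deriv_le_one (hH' : ∀ t, HasDerivAt H (H' t) t)
    (hH1 : ∀ t, |H' t| ≤ 1) (x y : ℝ) : |H x - H y| ≤ |x - y| := by
  have := Convex.norm_image_sub_le_of_norm_hasDerivWithin_le (s := univ) (C := 1)
    (fun t _ => (hH' t).hasDerivWithinAt) (fun t _ => hH1 t) convex_univ
    (mem_univ y) (mem_univ x)
  simpa using this

/-- Solution of the Beta Stein equation built from a primitive of the weighted right-hand side. -/
theorem exists_isBetaSteinSolution_of_primitive (ha : 0 < a) (hb : 0 < b)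
    (hI : ContinuousOn I (Icc 0 1))
    (hI' : ∀ t ∈ Ioo (0 : ℝ) 1, HasDerivAt I (t ^ (a - 1) * (1 - t) ^ (b - 1) * H t) t)
    (h0 : I 0 = 0) (h1 : I 1 = 0) (hH' : ∀ t, HasDerivAt H (H' t) t)
    (hH1 : ∀ t, |H' t| ≤ 1) :
    ∃ f f', IsBetaSteinSolution a b (steinDerivBound a b) H f f' := by
  have hab : 0 < a + b := by positivity
  have hHlip := abs_sub_le_of_abs_deriv_le_one hH' hH1
  have hHc : Continuous H := continuous_iff_continuousAt.2 fun t => (hH' t).continuousAt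
  have hIle : ∀ x ∈ Icc (0 : ℝ) 1, |I x| ≤ x ^ a * (1 - x) ^ b / (a + b) := fun x hx =>
    abs_primitive_le_of_lipschitz ha hb hI hI' h0 h1 hHlip hx
  set C := steinDerivBound a b with hC
  have hC0 : 0 ≤ C := steinDerivBound_nonneg ha hb
  have hpos : ∀ x ∈ Ioo (0 : ℝ) 1, 0 < x ^ a * (1 - x) ^ b := fun x hx =>
    mul_pos (Real.rpow_pos_of_pos hx.1 _) (Real.rpow_pos_of_pos (sub_pos.2 hx.2) _)
  have hw : ∀ x ∈ Ioo (0 : ℝ) 1,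
      x ^ a * (1 - x) ^ b = x ^ (a - 1) * (1 - x) ^ (b - 1) * (x * (1 - x)) := fun x hx => by
    have e1 : x ^ a = x ^ (a - 1) * x := by
      rw [← Real.rpow_add_one hx.1.ne']; congr 1; ring
    have e2 : (1 - x) ^ b = (1 - x) ^ (b - 1) * (1 - x) := by
      rw [← Real.rpow_add_one (sub_pos.2 hx.2).ne']; congr 1; ring
    rw [e1, e2]; ring
  -- `u x = x ^ (a + 1) * (1 - x) ^ (b + 1) * f' x` for the interior solution `f`
  set u : ℝ → ℝ := fun x => x ^ a * (1 - x) ^ b * H x - (a - (a + b) * x) * I x with hu_def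
  have hu : ContinuousOn u (Icc 0 1) := by
    refine ((continuous_rpow_mul_one_sub_rpow ha.le hb.le).mul hHc).continuousOn.sub
      (ContinuousOn.mul ?_ hI)
    fun_prop
  have hu' : ∀ t ∈ Ioo (0 : ℝ) 1, HasDerivAt u
      (t ^ a * (1 - t) ^ b * H' t + (a + b) * I t) t := fun t ht => by
    have h2 : HasDerivAt (fun x : ℝ => a - (a + b) * x) (-((a + b) * 1)) t :=
      ((hasDerivAt_id t).const_mul (a + b)).const_sub a
    exact (((hasDerivAt_rpow_mul_one_sub_rpow a b ht).mul (hH' t)).sub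
      (h2.mul (hI' t ht))).congr_deriv (by ring)
  have hule : ∀ t ∈ Ioo (0 : ℝ) 1,
      |t ^ a * (1 - t) ^ b * H' t + (a + b) * I t| ≤ 2 * (t ^ a * (1 - t) ^ b) := fun t ht => by
    refine (abs_add_le _ _).trans ?_
    rw [abs_mul (t ^ a * (1 - t) ^ b), abs_mul (a + b), abs_of_pos (hpos t ht), abs_of_pos hab]
    have e1 := mul_le_mul_of_nonneg_left (hH1 t) (hpos t ht).le
    have e2 := mul_le_mul_of_nonneg_left (hIle t (Ioo_subset_Icc_self ht)) hab.le
    rw [mul_div_cancel₀ _ hab.ne'] at e2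
    linarith
  have hubound : ∀ x ∈ Ioo (0 : ℝ) 1, |u x| ≤ C * (x ^ (a + 1) * (1 - x) ^ (b + 1)) :=
    fun x hx => abs_le_steinDerivBound ha hb hu hu' hule
      (by simp [hu_def, h0, Real.zero_rpow ha.ne']) (by simp [hu_def, h1, Real.zero_rpow hb.ne'])
      hx
  set f : ℝ → ℝ := fun x => if x = 0 then H 0 / a else if x = 1 then H 1 / -b
    else I x / (x ^ a * (1 - x) ^ b) with hf_def
  set f' : ℝ → ℝ := fun x => u x / (x ^ a * (1 - x) ^ b * (x * (1 - x))) with hf'_def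
  have hfin : ∀ x ∈ Ioo (0 : ℝ) 1, f x = I x / (x ^ a * (1 - x) ^ b) := fun x hx => by
    simp [hf_def, hx.1.ne', hx.2.ne]
  have heq : ∀ x ∈ Ioo (0 : ℝ) 1, x * (1 - x) * f' x + (a - (a + b) * x) * f x = H x :=
    fun x hx => by
      have := (hpos x hx).ne'
      have hx0 := hx.1.ne'
      have hx1 := (sub_pos.2 hx.2).ne'
      rw [hfin x hx]
      simp only [hf'_def, hu_def]
      generalize x ^ a * (1 - x) ^ b = q at *
      field_simp
      ring
  have hderiv : ∀ x ∈ Ioo (0 : ℝ) 1, HasDerivAt f (f' x) x := fun x hx => by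
    have hq := hpos x hx
    have h2 := (hI' x hx).div (hasDerivAt_rpow_mul_one_sub_rpow a b hx) hq.ne'
    have hev : f =ᶠ[𝓝 x] fun t => I t / (t ^ a * (1 - t) ^ b) := by
      filter_upwards [Ioo_mem_nhds hx.1 hx.2] with t ht using hfin t ht
    refine (h2.congr_of_eventuallyEq hev).congr_deriv ?_
    simp only [hf'_def, hu_def]
    rw [hw x hx] at hq ⊢
    have hp : x * (1 - x) ≠ 0 := mul_ne_zero hx.1.ne' (sub_pos.2 hx.2).ne'
    have hr : x ^ (a - 1) * (1 - x) ^ (b - 1) ≠ 0 := left_ne_zero_of_mul hq.ne'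
    generalize x ^ (a - 1) * (1 - x) ^ (b - 1) = r at *
    generalize x * (1 - x) = p at *
    field_simp
  have hf'le : ∀ x ∈ Ioo (0 : ℝ) 1, |f' x| ≤ C := fun x hx => by
    have hx1 := sub_pos.2 hx.2
    have hx0 := hx.1
    have hq := hpos x hx
    have := hubound x hx
    simp only [hf'_def]
    rw [abs_div, abs_of_pos (by positivity : 0 < x ^ a * (1 - x) ^ b * (x * (1 - x))),
      div_le_iff₀ (by positivity)]
    rw [Real.rpow_add_one hx0.ne', Real.rpow_add_one hx1.ne'] at this
    linarith
  -- near a zero `p` of `x * (1 - x)` the equation forces the boundary value of `f`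
  have hlim : ∀ p ∈ Icc (0 : ℝ) 1, p * (1 - p) = 0 → a - (a + b) * p ≠ 0 →
      Tendsto f (𝓝[Ioo 0 1] p) (𝓝 (H p / (a - (a + b) * p))) := fun p hp hp0 hpne => by
    have hz : Tendsto (fun x => x * (1 - x) * f' x) (𝓝[Ioo 0 1] p) (𝓝 0) := by
      have hc : Tendsto (fun x : ℝ => C * (x * (1 - x))) (𝓝[Ioo 0 1] p) (𝓝 0) := by
        have : Continuous (fun x : ℝ => C * (x * (1 - x))) := by fun_prop
        have h2 := (this.tendsto p).mono_left (nhdsWithin_le_nhds (s := Ioo 0 1))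
        rwa [hp0, mul_zero] at h2
      refine squeeze_zero_norm' ?_ hc
      filter_upwards [self_mem_nhdsWithin] with x hx
      have hpx : 0 < x * (1 - x) := mul_pos hx.1 (sub_pos.2 hx.2)
      rw [Real.norm_eq_abs, abs_mul, abs_of_pos hpx, mul_comm]
      exact mul_le_mul_of_nonneg_right (hf'le x hx) hpx.le
    have hd : Continuous (fun x : ℝ => a - (a + b) * x) := by fun_prop
    have hd' := (hd.tendsto p).mono_left (nhdsWithin_le_nhds (s := Ioo 0 1))
    have hH'' := (hHc.tendsto p).mono_left (nhdsWithin_le_nhds (s := Ioo 0 1))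
    have hq := (hH''.sub hz).div hd' hpne
    rw [sub_zero] at hq
    refine hq.congr' ?_
    filter_upwards [self_mem_nhdsWithin, hd' (isOpen_ne.mem_nhds hpne)] with x hx hx'
    simp only [Pi.div_apply]
    rw [div_eq_iff hx', ← heq x hx]
    ring
  refine ⟨f, f', fun x hx => ?_, hderiv, heq, ?_, fun x hx => ?_, hf'le⟩
  · by_cases hx' : x ∈ Ioo (0 : ℝ) 1
    · exact (hderiv x hx').continuousAt.continuousWithinAt
    · have hx01 : x = 0 ∨ x = 1 := by
        by_contra hcon
        push Not at hcon
        exact hx' ⟨lt_of_le_of_ne hx.1 hcon.1.symm, lt_of_le_of_ne hx.2 hcon.2⟩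
      have hval : f x = H x / (a - (a + b) * x) := by
        rcases hx01 with rfl | rfl
        · simp [hf_def]
        · simp [hf_def]
      have hf_lim : Tendsto f (𝓝[Ioo 0 1] x) (𝓝 (f x)) := by
        rw [hval]
        refine hlim x hx ?_ ?_
        · rcases hx01 with rfl | rfl <;> simp
        · rcases hx01 with rfl | rfl
          · simpa using ha.ne'
          · simpa using hb.ne'
      have hsub : Icc (0 : ℝ) 1 ⊆ insert 0 (insert 1 (Ioo 0 1)) := fun t ht => by
        by_cases h3 : t = 0
        · simp [h3]
        by_cases h4 : t = 1
        · simp [h4]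
        exact Or.inr (Or.inr ⟨lt_of_le_of_ne ht.1 (Ne.symm h3), lt_of_le_of_ne ht.2 h4⟩)
      exact (continuousWithinAt_insert.2 (continuousWithinAt_insert.2 hf_lim)).mono hsub
  · have : f 1 = H 1 / -b := by simp [hf_def]
    rw [this]
    field_simp
  · rw [hfin x hx, abs_div, abs_of_pos (hpos x hx), div_le_iff₀ (hpos x hx)]
    have := hIle x (Ioo_subset_Icc_self hx)
    rwa [one_div_mul_eq_div]

end SteinSolution

section BetaIntegrals

variable {a b : ℝ}

theorem integrableOn_betaWeight (ha : 0 < a) (hb : 0 < b) :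
    IntegrableOn (fun x : ℝ => x ^ (a - 1) * (1 - x) ^ (b - 1)) (Ioo 0 1) := by
  have h := (intervalIntegrable_iff_integrableOn_Ioo_of_le zero_le_one).1
    (Complex.betaIntegral_convergent (u := a) (v := b) (by simpa) (by simpa))
  refine IntegrableOn.congr_fun h.norm (fun x hx => ?_) measurableSet_Ioo
  have e : (1 : ℂ) - (x : ℂ) = ((1 - x : ℝ) : ℂ) := by push_cast; rfl
  simp only [norm_mul]
  rw [e, Complex.norm_cpow_eq_rpow_re_of_pos hx.1,
    Complex.norm_cpow_eq_rpow_re_of_pos (sub_pos.2 hx.2)]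
  simp

theorem integral_betaWeight (ha : 0 < a) (hb : 0 < b) :
    ∫ x in Ioo (0 : ℝ) 1, x ^ (a - 1) * (1 - x) ^ (b - 1)
      = Real.Gamma a * Real.Gamma b / Real.Gamma (a + b) := by
  have hc := Complex.betaIntegral_convergent (u := a) (v := b) (by simpa) (by simpa)
  rw [intervalIntegrable_iff_integrableOn_Ioo_of_le zero_le_one] at hc
  have hB := ProbabilityTheory.beta_eq_betaIntegralReal a b ha hb
  rw [ProbabilityTheory.beta] at hB
  rw [hB, Complex.betaIntegral, intervalIntegral.integral_of_le zero_le_one,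
    integral_Ioc_eq_integral_Ioo, ← RCLike.re_to_complex, ← integral_re hc]
  refine setIntegral_congr_fun measurableSet_Ioo fun x hx => ?_
  have e : (1 : ℂ) - (x : ℂ) = ((1 - x : ℝ) : ℂ) := by push_cast; rfl
  rw [e, ← Complex.ofReal_one, ← Complex.ofReal_sub, ← Complex.ofReal_sub,
    ← Complex.ofReal_cpow hx.1.le, ← Complex.ofReal_cpow (sub_pos.2 hx.2).le,
    ← Complex.ofReal_mul, RCLike.re_to_complex, Complex.ofReal_re]

theorem integrableOn_betaWeight_mul (ha : 0 < a) (hb : 0 < b) {h : ℝ → ℝ} (hh : Continuous h) :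
    IntegrableOn (fun x : ℝ => x ^ (a - 1) * (1 - x) ^ (b - 1) * h x) (Ioo 0 1) := by
  rw [← integrableOn_Icc_iff_integrableOn_Ioo]
  exact ((integrableOn_Icc_iff_integrableOn_Ioo).2 (integrableOn_betaWeight ha hb)).mul_continuousOn
    hh.continuousOn isCompact_Icc

theorem betaExp_eq_mul_integral (a b : ℝ) (h : ℝ → ℝ) :
    betaExp a b h = Real.Gamma (a + b) / (Real.Gamma a * Real.Gamma b)
      * ∫ x in Ioo (0 : ℝ) 1, x ^ (a - 1) * (1 - x) ^ (b - 1) * h x := by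
  rw [betaExp, ← integral_const_mul]
  simp only [mul_assoc]

theorem integral_betaWeight_mul_eq (ha : 0 < a) (hb : 0 < b) (h : ℝ → ℝ) :
    ∫ x in Ioo (0 : ℝ) 1, x ^ (a - 1) * (1 - x) ^ (b - 1) * h x
      = Real.Gamma a * Real.Gamma b / Real.Gamma (a + b) * betaExp a b h := by
  have h1 := Real.Gamma_pos_of_pos ha
  have h2 := Real.Gamma_pos_of_pos hb
  have h3 := Real.Gamma_pos_of_pos (add_pos ha hb)
  rw [betaExp_eq_mul_integral]
  field_simp

theorem integral_betaWeight_mul_sub_betaExp (ha : 0 < a) (hb : 0 < b) {h : ℝ → ℝ}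
    (hh : Continuous h) :
    ∫ x in Ioo (0 : ℝ) 1, x ^ (a - 1) * (1 - x) ^ (b - 1) * (h x - betaExp a b h) = 0 := by
  simp only [mul_sub]
  rw [integral_sub (integrableOn_betaWeight_mul ha hb hh)
    ((integrableOn_betaWeight ha hb).mul_const _), integral_mul_const, integral_betaWeight ha hb,
    integral_betaWeight_mul_eq ha hb, sub_self]

theorem abs_betaExp_sub_le (ha : 0 < a) (hb : 0 < b) {g h : ℝ → ℝ} (hg : Continuous g)
    (hh : Continuous h) {ε : ℝ} (hε : ∀ x, |g x - h x| ≤ ε) :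
    |betaExp a b g - betaExp a b h| ≤ ε := by
  have h1 := Real.Gamma_pos_of_pos ha
  have h2 := Real.Gamma_pos_of_pos hb
  have h3 := Real.Gamma_pos_of_pos (add_pos ha hb)
  have key : |∫ x in Ioo (0 : ℝ) 1, x ^ (a - 1) * (1 - x) ^ (b - 1) * (g x - h x)|
      ≤ Real.Gamma a * Real.Gamma b / Real.Gamma (a + b) * ε := by
    rw [← integral_betaWeight ha hb, ← integral_mul_const, ← Real.norm_eq_abs]
    refine norm_integral_le_of_norm_le ((integrableOn_betaWeight ha hb).mul_const _) ?_
    refine ae_restrict_of_forall_mem measurableSet_Ioo fun x hx => ?_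
    have hx0 := hx.1
    have hx1 := sub_pos.2 hx.2
    rw [Real.norm_eq_abs, abs_mul, abs_of_pos (by positivity)]
    gcongr
    exact hε x
  simp only [mul_sub] at key
  rw [integral_sub (integrableOn_betaWeight_mul ha hb hg) (integrableOn_betaWeight_mul ha hb hh),
    integral_betaWeight_mul_eq ha hb, integral_betaWeight_mul_eq ha hb, ← mul_sub, abs_mul,
    abs_of_pos (by positivity)] at key
  exact le_of_mul_le_mul_left key (by positivity)

theorem exists_isBetaSteinSolution (ha : 0 < a) (hb : 0 < b) {h h' : ℝ → ℝ}
    (hh' : ∀ t, HasDerivAt h (h' t) t) (hh1 : ∀ t, |h' t| ≤ 1) :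
    ∃ f f', IsBetaSteinSolution a b (steinDerivBound a b)
      (fun x => h x - betaExp a b h) f f' := by
  have hc : Continuous h := continuous_iff_continuousAt.2 fun t => (hh' t).continuousAt
  have hc' : Continuous (fun x => h x - betaExp a b h) := hc.sub continuous_const
  set w : ℝ → ℝ := fun x => x ^ (a - 1) * (1 - x) ^ (b - 1) * (h x - betaExp a b h) with hw
  have hw_int : IntervalIntegrable w volume 0 1 :=
    (intervalIntegrable_iff_integrableOn_Ioo_of_le zero_le_one).2
      (integrableOn_betaWeight_mul ha hb hc')
  refine exists_isBetaSteinSolution_of_primitive (I := fun x => ∫ t in (0 : ℝ)..x, w t) ha hb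
    ?_ (fun t ht => ?_) ?_ ?_ (fun t => (hh' t).sub_const _) hh1
  · have := intervalIntegral.continuousOn_primitive_interval' hw_int left_mem_uIcc
    rwa [uIcc_of_le zero_le_one] at this
  · have hcw : ∀ s ∈ Ioo (0 : ℝ) 1, ContinuousAt w s := fun s hs =>
      ((hasDerivAt_rpow_mul_one_sub_rpow (a - 1) (b - 1) hs).continuousAt).mul hc'.continuousAt
    refine intervalIntegral.integral_hasDerivAt_right (f := w) ?_ ?_ (hcw t ht)
    · exact hw_int.mono_set (by
        rw [uIcc_of_le ht.1.le, uIcc_of_le zero_le_one]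
        exact Icc_subset_Icc_right ht.2.le)
    · exact ContinuousAt.stronglyMeasurableAtFilter isOpen_Ioo hcw t ht
  · simp
  · rw [intervalIntegral.integral_of_le zero_le_one, integral_Ioc_eq_integral_Ioo]
    exact integral_betaWeight_mul_sub_betaExp ha hb hc

end BetaIntegrals

section Smoothing

/-- A `1`-Lipschitz function is a uniform limit of differentiable `1`-Lipschitz functions. -/
theorem exists_hasDerivAt_near_of_lipschitz {h : ℝ → ℝ} (hLip : LipschitzWith 1 h) {ε : ℝ}
    (hε : 0 < ε) : ∃ g g' : ℝ → ℝ, (∀ t, HasDerivAt g (g' t) t) ∧ (∀ t, |g' t| ≤ 1) ∧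
      ∀ t, |h t - g t| ≤ ε := by
  have hlip : ∀ x y, |h x - h y| ≤ |x - y| := fun x y => by
    simpa [Real.dist_eq] using hLip.dist_le_mul x y
  set F : ℝ → ℝ := fun x => ∫ t in (0 : ℝ)..x, h t with hF
  have hF' : ∀ x, HasDerivAt F (h x) x := fun x => hLip.continuous.integral_hasStrictDerivAt 0 x
    |>.hasDerivAt
  refine ⟨fun x => (F (x + ε) - F x) / ε, fun x => (h (x + ε) - h x) / ε,
    fun t => (((hF' (t + ε)).comp_add_const t ε).sub (hF' t)).div_const ε, fun t => ?_,
    fun t => ?_⟩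
  · rw [abs_div, abs_of_pos hε, div_le_one hε]
    simpa [abs_of_pos hε] using hlip (t + ε) t
  · obtain ⟨c, hc, hc'⟩ := exists_hasDerivAt_eq_slope F h (by linarith : t < t + ε)
      (fun x _ => (hF' x).continuousAt.continuousWithinAt) (fun x _ => hF' x)
    rw [add_sub_cancel_left] at hc'
    beta_reduce
    rw [← hc']
    refine (hlip t c).trans ?_
    rw [abs_le]
    constructor <;> linarith [hc.1, hc.2]

end Smoothing

/-- With `S_n` the number of white balls drawn from the
Pólya–Eggenberger urn, `W_n = S_n/n` and `Z ∼ B(α/m, β/m)`,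
`d_W(W_n, Z) ≤ ((m + max(α,β))/(2nm) + αβ/(nm(α+β))) (b₀ + b₁) + 3/(2n)`,
stated as: the bound holds for `|E h(W_n) - E h(Z)|` for every
`1`-Lipschitz `h`. -/
theorem stmt_10 (α β m : ℕ) (hα : 1 ≤ α) (hβ : 1 ≤ β) (hm : 1 ≤ m)
    (n : ℕ) (hn : 1 ≤ n) (h : ℝ → ℝ) (hLip : LipschitzWith 1 h) :
    |∑ k ∈ Finset.range (n + 1), urnPmf α β m n k * h ((k : ℝ) / n)
        - betaExp ((α : ℝ) / m) ((β : ℝ) / m) h|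
      ≤ (((m : ℝ) + max (α : ℝ) (β : ℝ)) / (2 * n * m)
            + (α : ℝ) * (β : ℝ) / (n * m * ((α : ℝ) + (β : ℝ))))
          * (b₀ ((α : ℝ) / m) ((β : ℝ) / m) + b₁ ((α : ℝ) / m) ((β : ℝ) / m))
        + 3 / (2 * n) := by
  have ha : 0 < (α : ℝ) / m := by positivity
  have hb : 0 < (β : ℝ) / m := by positivity
  refine le_of_forall_pos_le_add fun ε hε => ?_
  obtain ⟨g, g', hg', hg1, hgε⟩ := exists_hasDerivAt_near_of_lipschitz hLip (half_pos hε)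
  obtain ⟨f, f', hf⟩ := exists_isBetaSteinSolution ha hb hg' hg1
  have hgc : Continuous g := continuous_iff_continuousAt.2 fun t => (hg' t).continuousAt
  have hsum := sum_urnPmf (α := α) (β := β) (m := m) n hα hβ hm
  have hmain := hf.abs_sum_urnPmf_le hα hβ hm hn (steinDerivBound_nonneg ha hb)
    (fun x y => by simpa using abs_sub_le_of_abs_deriv_le_one hg' hg1 x y)
  simp only [mul_sub, Finset.sum_sub_distrib, ← Finset.sum_mul, hsum, one_mul] at hmain
  have hE := abs_betaExp_sub_le ha hb hLip.continuous hgc hgε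
  have hS : |∑ k ∈ Finset.range (n + 1), urnPmf α β m n k * h ((k : ℝ) / n)
      - ∑ k ∈ Finset.range (n + 1), urnPmf α β m n k * g ((k : ℝ) / n)| ≤ ε / 2 := by
    rw [← Finset.sum_sub_distrib]
    calc _ ≤ ∑ k ∈ Finset.range (n + 1), urnPmf α β m n k * (ε / 2) := by
          refine (Finset.abs_sum_le_sum_abs _ _).trans (Finset.sum_le_sum fun k _ => ?_)
          have hp := urnPmf_nonneg α β m n k hα hβ hm
          rw [← mul_sub, abs_mul, abs_of_nonneg hp]
          exact mul_le_mul_of_nonneg_left (hgε _) hp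
      _ = ε / 2 := by rw [← Finset.sum_mul, hsum, one_mul]
  have hconst := mul_le_mul_of_nonneg_left (steinDerivBound_le ha hb)
    (by positivity : 0 ≤ ((m : ℝ) + max (α : ℝ) (β : ℝ)) / (2 * n * m)
      + (α : ℝ) * (β : ℝ) / (n * m * ((α : ℝ) + (β : ℝ))))
  have hlast : (1 : ℝ) / n ≤ 3 / (2 * n) := by
    have hn' : (0 : ℝ) < n := by positivity
    rw [div_le_div_iff₀ hn' (by positivity)]
    linarith
  rw [abs_le] at hmain hE hS ⊢
  constructor <;> linarith [hmain.1, hmain.2, hE.1, hE.2, hS.1, hS.2]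
end

section
/- Let n ≥ 1 and let K be a random variable on {0,1,…,n} with P(K = k) = u_{2k} u_{2n−2k}, where u_{2m} = 2^{−2m} C(2m, m), so that K/n is distributed as L_{2n}/(2n) where L_{2n} is the last return time to zero of a simple symmetric random walk of length 2n. Let Z have the Arcsine distribution, i.e. the Beta distribution B(1/2, 1/2). Then d_W(K/n, Z) ≤ 27/(2n) + 8/n². -/
open MeasureTheory

/-- `u_{2m} = 2^{-2m} C(2m, m)`, the probability that a simple symmetric
random walk returns to zero at time `2m`. -/
noncomputable def u (m : ℕ) : ℝ := ((2 * m).choose m : ℝ) / 4 ^ m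

/-- The mass function of `K = L_{2n}/2`, where `L_{2n}` is the last return
time to zero of a simple symmetric random walk of length `2n`:
`P(K = k) = u_{2k} u_{2n-2k}` for `k = 0, 1, …, n`. -/
noncomputable def arcPmf (n k : ℕ) : ℝ := u k * u (n - k)

lemma u_pos (m : ℕ) : 0 < u m := by
  have : 0 < (2 * m).choose m := Nat.choose_pos (by lia)
  unfold u
  positivity

lemma succ_mul_u_succ (m : ℕ) : ((m : ℝ) + 1) * u (m + 1) = (m + 1 / 2) * u m := by
  have hc : ((m : ℝ) + 1) * (2 * (m + 1)).choose (m + 1)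
      = 2 * (2 * m + 1) * (2 * m).choose m := by
    exact_mod_cast Nat.succ_mul_centralBinom_succ m
  unfold u
  rw [← mul_div_assoc, hc, pow_succ]
  field_simp
  ring

lemma sum_arcPmf (n : ℕ) : ∑ k ∈ Finset.range (n + 1), arcPmf n k = 1 := by
  induction n with
  | zero => simp [arcPmf, u]
  | succ n ih =>
    have hsplit : ((n : ℝ) + 1) * ∑ k ∈ Finset.range (n + 2), arcPmf (n + 1) k
        = ∑ k ∈ Finset.range (n + 2), (k : ℝ) * arcPmf (n + 1) k
          + ∑ k ∈ Finset.range (n + 2), ((n : ℝ) + 1 - k) * arcPmf (n + 1) k := by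
      rw [Finset.mul_sum, ← Finset.sum_add_distrib]
      exact Finset.sum_congr rfl fun k _ => by ring
    have hleft : ∑ k ∈ Finset.range (n + 2), (k : ℝ) * arcPmf (n + 1) k
        = ∑ k ∈ Finset.range (n + 1), ((k : ℝ) + 1 / 2) * arcPmf n k := by
      rw [Finset.sum_range_succ']
      simp only [Nat.cast_zero, zero_mul, add_zero]
      refine Finset.sum_congr rfl fun k _ => ?_
      simp only [arcPmf, Nat.add_sub_add_right, Nat.cast_add, Nat.cast_one]
      rw [← mul_assoc, succ_mul_u_succ, mul_assoc]
    have hright : ∑ k ∈ Finset.range (n + 2), ((n : ℝ) + 1 - k) * arcPmf (n + 1) k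
        = ∑ k ∈ Finset.range (n + 1), ((n : ℝ) - k + 1 / 2) * arcPmf n k := by
      rw [Finset.sum_range_succ]
      simp only [Nat.cast_add, Nat.cast_one, sub_self, zero_mul, add_zero]
      refine Finset.sum_congr rfl fun k hk => ?_
      have hkn : k ≤ n := by simpa [Nat.lt_succ_iff] using hk
      have hs := succ_mul_u_succ (n - k)
      rw [Nat.cast_sub hkn] at hs
      simp only [arcPmf]
      rw [Nat.sub_add_comm hkn]
      linear_combination u k * hs
    rw [hleft, hright, ← Finset.sum_add_distrib] at hsplit
    have hsum : ∑ k ∈ Finset.range (n + 1),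
        (((k : ℝ) + 1 / 2) * arcPmf n k + ((n : ℝ) - k + 1 / 2) * arcPmf n k) = n + 1 := by
      rw [← mul_one ((n : ℝ) + 1), ← ih, Finset.mul_sum]
      exact Finset.sum_congr rfl fun k _ => by ring
    rw [hsum] at hsplit
    have hn : (n : ℝ) + 1 ≠ 0 := by positivity
    exact mul_left_cancel₀ hn (by linarith)

lemma u_sq_mul_wallis (m : ℕ) : u m ^ 2 * ((2 * m + 1) * Real.Wallis.W m) = 1 := by
  induction m with
  | zero => simp [u, Real.Wallis.W]
  | succ m ih =>
    have hs : u (m + 1) = (m + 1 / 2) * u m / (m + 1) := by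
      rw [← succ_mul_u_succ]
      field_simp
    refine Eq.trans ?_ ih
    rw [Real.Wallis.W_succ, hs]
    push_cast
    field_simp
    ring

lemma inv_sqrt_le_u (m : ℕ) : (√(Real.pi * (m + 1)))⁻¹ ≤ u m := by
  have hW := Real.Wallis.W_le m
  have hu := u_sq_mul_wallis m
  have hpos := u_pos m
  rw [← Real.sqrt_inv, Real.sqrt_le_left hpos.le, inv_le_iff_one_le_mul₀ (by positivity), ← hu]
  refine mul_le_mul_of_nonneg_left ?_ (by positivity)
  nlinarith [Real.pi_pos, (Nat.cast_nonneg m : (0 : ℝ) ≤ m)]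

lemma u_le_inv_sqrt {m : ℕ} (hm : 1 ≤ m) : u m ≤ (√(Real.pi * m))⁻¹ := by
  have hW := Real.Wallis.le_W m
  have hu := u_sq_mul_wallis m
  have hm' : (0 : ℝ) < m := by exact_mod_cast hm
  rw [← Real.sqrt_inv]
  refine Real.le_sqrt_of_sq_le ?_
  rw [le_inv_comm₀ (by have := u_pos m; positivity) (by positivity),
    ← eq_inv_of_mul_eq_one_right hu]
  refine le_trans ?_ (mul_le_mul_of_nonneg_left hW (by positivity))
  rw [← sub_nonneg]
  have : (2 * (m : ℝ) + 1) * ((2 * m + 1) / (2 * m + 2) * (Real.pi / 2)) - Real.pi * m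
      = Real.pi / (4 * (m + 1)) := by
    field_simp
    ring
  rw [this]
  positivity

lemma le_arcPmf {n k : ℕ} (hk : k ≤ n) :
    (Real.pi * √(((k : ℝ) + 1) * (n + 1 - k)))⁻¹ ≤ arcPmf n k := by
  have h1 := inv_sqrt_le_u k
  have h2 := inv_sqrt_le_u (n - k)
  have hk' : (k : ℝ) ≤ n := by exact_mod_cast hk
  rw [Nat.cast_sub hk] at h2
  refine le_trans (le_of_eq ?_) (mul_le_mul h1 h2 (by positivity) (u_pos k).le)
  rw [← mul_inv, ← Real.sqrt_mul (by positivity)]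
  congr 1
  rw [show Real.pi * ((k : ℝ) + 1) * (Real.pi * (n - k + 1))
      = Real.pi ^ 2 * ((k + 1) * (n + 1 - k)) by ring, Real.sqrt_mul (sq_nonneg _),
    Real.sqrt_sq Real.pi_pos.le]

lemma arcPmf_le {n k : ℕ} (hk₀ : 0 < k) (hk : k < n) :
    arcPmf n k ≤ (Real.pi * √((k : ℝ) * (n - k)))⁻¹ := by
  have h1 := u_le_inv_sqrt hk₀
  have h2 := u_le_inv_sqrt (m := n - k) (by lia)
  rw [Nat.cast_sub hk.le] at h2
  refine le_trans (mul_le_mul h1 h2 (u_pos _).le (by positivity)) (le_of_eq ?_)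
  rw [← mul_inv, ← Real.sqrt_mul (by positivity)]
  congr 1
  rw [show Real.pi * (k : ℝ) * (Real.pi * (n - k)) = Real.pi ^ 2 * (k * (n - k)) by ring,
    Real.sqrt_mul (sq_nonneg _), Real.sqrt_sq Real.pi_pos.le]

/-- The arcsine density; it vanishes outside `(0, 1)` by the conventions for `√` and `⁻¹`. -/
noncomputable def arcDensity (x : ℝ) : ℝ := (Real.pi * √(x * (1 - x)))⁻¹

lemma arcDensity_nonneg (x : ℝ) : 0 ≤ arcDensity x := by
  have := Real.pi_pos
  unfold arcDensity
  positivity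

lemma arcDensity_one_sub (x : ℝ) : arcDensity (1 - x) = arcDensity x := by
  unfold arcDensity
  ring_nf

lemma measurable_arcDensity : Measurable arcDensity := by
  unfold arcDensity
  fun_prop

lemma arcDensity_eq_of_mem_Ioo {x : ℝ} (hx : x ∈ Set.Ioo (0 : ℝ) 1) :
    Real.Gamma (1 / 2 + 1 / 2) / (Real.Gamma (1 / 2) * Real.Gamma (1 / 2))
      * x ^ ((1 : ℝ) / 2 - 1) * (1 - x) ^ ((1 : ℝ) / 2 - 1) = arcDensity x := by
  have hx0 := hx.1
  have hx1 : 0 < 1 - x := sub_pos.2 hx.2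
  rw [Real.Gamma_one_half_eq, Real.mul_self_sqrt Real.pi_pos.le, add_halves, Real.Gamma_one,
    show (1 : ℝ) / 2 - 1 = -(1 / 2) by norm_num, Real.rpow_neg hx0.le, Real.rpow_neg hx1.le,
    ← Real.sqrt_eq_rpow, ← Real.sqrt_eq_rpow, arcDensity, Real.sqrt_mul hx0.le, mul_inv, mul_inv,
    one_div, mul_assoc]

lemma arcDensity_eq_zero_of_notMem {x : ℝ} (hx : x ∉ Set.Ioo (0 : ℝ) 1) : arcDensity x = 0 := by
  have : x * (1 - x) ≤ 0 := by
    rcases le_or_gt x 0 with h | h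
    · exact mul_nonpos_of_nonpos_of_nonneg h (by linarith)
    · exact mul_nonpos_of_nonneg_of_nonpos h.le (by
        simp only [Set.mem_Ioo, not_and, not_lt] at hx
        linarith [hx h])
  simp [arcDensity, Real.sqrt_eq_zero_of_nonpos this]

lemma lintegral_arcDensity : ∫⁻ x, ENNReal.ofReal (arcDensity x) = 1 := by
  rw [← ProbabilityTheory.lintegral_betaPDF_eq_one (α := 1 / 2) (β := 1 / 2)
    (by norm_num) (by norm_num)]
  congr 1
  ext x
  rw [ProbabilityTheory.betaPDF_eq]
  congr 1
  split_ifs with hx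
  · rw [← arcDensity_eq_of_mem_Ioo hx, ProbabilityTheory.beta, one_div_div]
  · exact arcDensity_eq_zero_of_notMem hx

lemma integrable_arcDensity : Integrable arcDensity := by
  refine ⟨measurable_arcDensity.aestronglyMeasurable, ?_⟩
  rw [hasFiniteIntegral_iff_ofReal (Filter.Eventually.of_forall arcDensity_nonneg),
    lintegral_arcDensity]
  exact ENNReal.one_lt_top

lemma integral_arcDensity : ∫ x in (0 : ℝ)..1, arcDensity x = 1 := by
  rw [intervalIntegral.integral_eq_integral_of_support_subset,
    integral_eq_lintegral_of_nonneg_ae (Filter.Eventually.of_forall arcDensity_nonneg)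
      measurable_arcDensity.aestronglyMeasurable, lintegral_arcDensity, ENNReal.toReal_one]
  intro x hx
  by_contra hx'
  exact hx (arcDensity_eq_zero_of_notMem fun h => hx' (Set.Ioo_subset_Ioc_self h))

lemma intervalIntegrable_arcDensity_mul {g : ℝ → ℝ} (hg : Continuous g) (a b : ℝ) :
    IntervalIntegrable (fun x => arcDensity x * g x) volume a b :=
  integrable_arcDensity.intervalIntegrable.mul_continuousOn hg.continuousOn

lemma betaExp_half_half (h : ℝ → ℝ) :
    betaExp (1 / 2) (1 / 2) h = ∫ x in (0 : ℝ)..1, arcDensity x * h x := by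
  rw [intervalIntegral.integral_of_le zero_le_one, integral_Ioc_eq_integral_Ioo, betaExp]
  exact setIntegral_congr_fun measurableSet_Ioo fun x hx => by
    simp only [arcDensity_eq_of_mem_Ioo hx]

/-- The arcsine probability of the cell `[k / (n + 1), (k + 1) / (n + 1)]`. -/
noncomputable def arcCell (n k : ℕ) : ℝ :=
  ∫ x in ((k : ℝ) / (n + 1))..(((k + 1 : ℕ) : ℝ) / (n + 1)), arcDensity x

lemma sum_cell_integral {g : ℝ → ℝ} (hg : Continuous g) (n : ℕ) :
    ∑ k ∈ Finset.range (n + 1),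
        ∫ x in ((k : ℝ) / (n + 1))..(((k + 1 : ℕ) : ℝ) / (n + 1)), arcDensity x * g x
      = ∫ x in (0 : ℝ)..1, arcDensity x * g x := by
  have hn : (n : ℝ) + 1 ≠ 0 := by positivity
  rw [intervalIntegral.sum_integral_adjacent_intervals (a := fun k : ℕ => (k : ℝ) / (n + 1))
    fun k _ => intervalIntegrable_arcDensity_mul hg _ _]
  simp [hn]

lemma sum_arcCell (n : ℕ) : ∑ k ∈ Finset.range (n + 1), arcCell n k = 1 := by
  have := sum_cell_integral (g := fun _ => 1) continuous_const n
  simpa only [mul_one, integral_arcDensity, arcCell] using this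

lemma cell_le (n k : ℕ) : (k : ℝ) / (n + 1) ≤ ((k + 1 : ℕ) : ℝ) / (n + 1) := by
  gcongr
  lia

lemma arcCell_nonneg (n k : ℕ) : 0 ≤ arcCell n k :=
  intervalIntegral.integral_nonneg (cell_le n k) fun x _ => arcDensity_nonneg x

lemma integral_cell_const (n k : ℕ) (c : ℝ) :
    ∫ _ in ((k : ℝ) / (n + 1))..(((k + 1 : ℕ) : ℝ) / (n + 1)), c = c / (n + 1) := by
  rw [intervalIntegral.integral_const, smul_eq_mul]
  push_cast
  field_simp
  ring

lemma inv_div_succ (n : ℕ) (s : ℝ) :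
    (Real.pi * √(s / ((n : ℝ) + 1) ^ 2))⁻¹ / (n + 1) = (Real.pi * √s)⁻¹ := by
  have hn : (0 : ℝ) < (n : ℝ) + 1 := by positivity
  rw [Real.sqrt_div' _ (by positivity), Real.sqrt_sq hn.le, mul_div_assoc', inv_div,
    div_div_cancel_left' hn.ne']

lemma le_arcCell {n k : ℕ} (hk₀ : 0 < k) (hk : k < n) :
    (Real.pi * √(((k : ℝ) + 1) * (n + 1 - k)))⁻¹ ≤ arcCell n k := by
  have hk₀' : (0 : ℝ) < k := by exact_mod_cast hk₀
  have hk' : (k : ℝ) + 1 ≤ n := by exact_mod_cast hk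
  rw [← inv_div_succ n, ← integral_cell_const n k]
  refine intervalIntegral.integral_mono_on (cell_le n k) (by simp)
    integrable_arcDensity.intervalIntegrable fun x hx => ?_
  have hN : (0 : ℝ) < (n : ℝ) + 1 := by positivity
  obtain ⟨h1, h2⟩ := hx
  rw [div_le_iff₀ hN] at h1
  rw [le_div_iff₀ hN] at h2
  push_cast at h2
  have hx0 : 0 < x := by
    by_contra hneg
    nlinarith
  have hx1 : 0 < 1 - x := by
    by_contra hneg
    nlinarith
  unfold arcDensity
  gcongr
  rw [le_div_iff₀ (by positivity)]
  calc x * (1 - x) * ((n : ℝ) + 1) ^ 2 = (x * (n + 1)) * (n + 1 - x * (n + 1)) := by ring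
    _ ≤ _ := mul_le_mul h2 (by linarith) (by nlinarith) (by positivity)

lemma arcCell_le {n k : ℕ} (hk₀ : 0 < k) (hk : k < n) :
    arcCell n k ≤ (Real.pi * √((k : ℝ) * (n - k)))⁻¹ := by
  have hk₀' : (0 : ℝ) < k := by exact_mod_cast hk₀
  have hk' : (k : ℝ) + 1 ≤ n := by exact_mod_cast hk
  have hnk : (0 : ℝ) < n - k := by linarith
  rw [← inv_div_succ n, ← integral_cell_const n k]
  refine intervalIntegral.integral_mono_on (cell_le n k)
    integrable_arcDensity.intervalIntegrable (by simp) fun x hx => ?_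
  have hN : (0 : ℝ) < (n : ℝ) + 1 := by positivity
  obtain ⟨h1, h2⟩ := hx
  rw [div_le_iff₀ hN] at h1
  rw [le_div_iff₀ hN] at h2
  push_cast at h2
  unfold arcDensity
  gcongr
  rw [div_le_iff₀ (by positivity)]
  calc (k : ℝ) * (n - k) ≤ (x * (n + 1)) * (n + 1 - x * (n + 1)) :=
        mul_le_mul h1 (by linarith) hnk.le (by linarith)
    _ = _ := by ring

lemma abs_arcPmf_sub_arcCell_mul_le {n k : ℕ} (hk : k ≤ n) {c : ℝ}
    (hc₀ : |c| ≤ (k : ℝ) / n) (hc₁ : |c| ≤ 1 - (k : ℝ) / n) :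
    |arcPmf n k - arcCell n k| * |c| ≤ ((n : ℝ) + 1) / n ^ 2 * arcPmf n k := by
  have hp : 0 ≤ arcPmf n k := mul_nonneg (u_pos _).le (u_pos _).le
  rcases Nat.eq_zero_or_pos k with rfl | hk₀
  · rw [Nat.cast_zero, zero_div] at hc₀
    rw [le_antisymm hc₀ (abs_nonneg c), mul_zero]
    positivity
  have hn' : (0 : ℝ) < n := by exact_mod_cast hk₀.trans_le hk
  rcases hk.eq_or_lt with rfl | hkn
  · rw [div_self hn'.ne', sub_self] at hc₁
    rw [le_antisymm hc₁ (abs_nonneg c), mul_zero]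
    positivity
  have hk₀' : (0 : ℝ) < k := by exact_mod_cast hk₀
  have hnk : (0 : ℝ) < n - k := sub_pos.2 (by exact_mod_cast hkn)
  have hp1 := le_arcPmf hk
  have hp2 := arcPmf_le hk₀ hkn
  have hq1 := le_arcCell hk₀ hkn
  have hq2 := arcCell_le hk₀ hkn
  set a := √((k : ℝ) * (n - k))
  set b := √(((k : ℝ) + 1) * (n + 1 - k))
  have ha0 : 0 < a := Real.sqrt_pos.2 (by positivity)
  have hb0 : 0 < b := Real.sqrt_pos.2 (mul_pos (by positivity) (by linarith))
  have ha2 : a ^ 2 = k * (n - k) := Real.sq_sqrt (by positivity)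
  have hb2 : b ^ 2 = (k + 1) * (n + 1 - k) :=
    Real.sq_sqrt (mul_nonneg (by positivity) (by linarith))
  have hab : a ≤ b := Real.sqrt_le_sqrt (by nlinarith)
  have hd : |arcPmf n k - arcCell n k| ≤ (Real.pi * a)⁻¹ - (Real.pi * b)⁻¹ := by
    rw [abs_le]
    constructor <;> linarith
  have hc : |c| ≤ 2 * a ^ 2 / n ^ 2 := by
    have hx : (2 : ℝ) * a ^ 2 / n ^ 2 = 2 * ((k : ℝ) / n) * (1 - k / n) := by
      rw [ha2]
      field_simp
    rw [hx]
    have hx₁ := (abs_nonneg c).trans hc₁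
    have : (0 : ℝ) < k / n := by positivity
    rcases le_total ((k : ℝ) / n) (1 / 2) with h | h <;> nlinarith
  have hba : 2 * a * (b - a) ≤ n + 1 := by nlinarith [sq_nonneg (b - a)]
  calc |arcPmf n k - arcCell n k| * |c|
      ≤ ((Real.pi * a)⁻¹ - (Real.pi * b)⁻¹) * (2 * a ^ 2 / n ^ 2) :=
        mul_le_mul hd hc (abs_nonneg c) ((abs_nonneg _).trans hd)
    _ = (2 * a * (b - a)) / n ^ 2 * (Real.pi * b)⁻¹ := by
        field_simp
    _ ≤ ((n : ℝ) + 1) / n ^ 2 * arcPmf n k := by gcongr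

lemma abs_cell_integral_sub_le {n k : ℕ} (hn : 1 ≤ n) (hk : k ≤ n) {g : ℝ → ℝ}
    (hg : LipschitzWith 1 g) :
    |(∫ x in ((k : ℝ) / (n + 1))..(((k + 1 : ℕ) : ℝ) / (n + 1)), arcDensity x * g x)
        - arcCell n k * g ((k : ℝ) / n)| ≤ 1 / n * arcCell n k := by
  have hn' : (0 : ℝ) < n := by exact_mod_cast hn
  have hk' : (k : ℝ) ≤ n := by exact_mod_cast hk
  have hN : (0 : ℝ) < (n : ℝ) + 1 := by positivity
  have hint := (integrable_arcDensity.intervalIntegrable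
    (a := (k : ℝ) / (n + 1)) (b := ((k + 1 : ℕ) : ℝ) / (n + 1)))
  rw [arcCell, ← intervalIntegral.integral_mul_const, ← intervalIntegral.integral_sub
    (intervalIntegrable_arcDensity_mul hg.continuous _ _) (hint.mul_const _),
    ← intervalIntegral.integral_const_mul, ← Real.norm_eq_abs]
  refine intervalIntegral.norm_integral_le_of_norm_le (cell_le n k)
    (Filter.Eventually.of_forall fun x hx => ?_) (hint.const_mul _)
  rw [← mul_sub, norm_mul, Real.norm_of_nonneg (arcDensity_nonneg x), mul_comm]
  refine mul_le_mul_of_nonneg_right ?_ (arcDensity_nonneg x)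
  refine (hg.norm_sub_le x _).trans ?_
  rw [NNReal.coe_one, one_mul, Real.norm_eq_abs, abs_le]
  obtain ⟨h1, h2⟩ := hx
  rw [div_lt_iff₀ hN] at h1
  rw [le_div_iff₀ hN] at h2
  push_cast at h2
  have hx1 : x ≤ 1 := by nlinarith
  have hx0 : 0 ≤ x := by
    by_contra hneg
    nlinarith [(Nat.cast_nonneg k : (0 : ℝ) ≤ k)]
  rw [sub_div' hn'.ne', ← neg_div, div_le_div_iff_of_pos_right hn',
    div_le_div_iff_of_pos_right hn']
  constructor <;> nlinarith

/-- The test function `h` symmetrized about `1/2` and normalized to vanish at `0` and `1`. -/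
noncomputable def symmetrize (h : ℝ → ℝ) (x : ℝ) : ℝ := (h x + h (1 - x) - h 0 - h 1) / 2

lemma lipschitzWith_symmetrize {h : ℝ → ℝ} (hLip : LipschitzWith 1 h) :
    LipschitzWith 1 (symmetrize h) := by
  refine LipschitzWith.of_dist_le_mul fun x y => ?_
  have h1 := hLip.dist_le_mul x y
  have h2 := hLip.dist_le_mul (1 - x) (1 - y)
  rw [dist_sub_left] at h2
  simp only [NNReal.coe_one, one_mul, Real.dist_eq, symmetrize] at *
  rw [abs_le] at *
  constructor <;> linarith

lemma abs_symmetrize_le {h : ℝ → ℝ} (hLip : LipschitzWith 1 h) {x : ℝ}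
    (hx₀ : 0 ≤ x) (hx₁ : x ≤ 1) : |symmetrize h x| ≤ x ∧ |symmetrize h x| ≤ 1 - x := by
  have hs := lipschitzWith_symmetrize hLip
  have h0 := hs.dist_le_mul x 0
  have h1 := hs.dist_le_mul x 1
  have e0 : symmetrize h 0 = 0 := by simp [symmetrize]
  have e1 : symmetrize h 1 = 0 := by simp [symmetrize]
  simp only [NNReal.coe_one, one_mul, Real.dist_eq, e0, e1, sub_zero] at h0 h1
  rw [abs_of_nonneg hx₀] at h0
  rw [abs_sub_comm x 1, abs_of_nonneg (sub_nonneg.2 hx₁)] at h1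
  exact ⟨h0, h1⟩

lemma sum_arcPmf_mul_symmetrize {n : ℕ} (hn : 1 ≤ n) (h : ℝ → ℝ) :
    ∑ k ∈ Finset.range (n + 1), arcPmf n k * symmetrize h ((k : ℝ) / n)
      = ∑ k ∈ Finset.range (n + 1), arcPmf n k * h ((k : ℝ) / n) - (h 0 + h 1) / 2 := by
  have hn' : (n : ℝ) ≠ 0 := by exact_mod_cast (by lia : n ≠ 0)
  have hrefl : ∑ k ∈ Finset.range (n + 1), arcPmf n k * h (1 - (k : ℝ) / n)
      = ∑ k ∈ Finset.range (n + 1), arcPmf n k * h ((k : ℝ) / n) := by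
    rw [← Finset.sum_range_reflect]
    refine Finset.sum_congr rfl fun k hk => ?_
    have hkn : k ≤ n := by simpa [Nat.lt_succ_iff] using hk
    rw [show n + 1 - 1 - k = n - k by lia, Nat.cast_sub hkn, arcPmf, arcPmf, Nat.sub_sub_self hkn,
      mul_comm (u k), sub_div, div_self hn', sub_sub_cancel]
  have hsum : ∑ k ∈ Finset.range (n + 1), arcPmf n k * symmetrize h ((k : ℝ) / n)
      = (∑ k ∈ Finset.range (n + 1), arcPmf n k * h ((k : ℝ) / n)
          + ∑ k ∈ Finset.range (n + 1), arcPmf n k * h (1 - (k : ℝ) / n)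
          - (∑ k ∈ Finset.range (n + 1), arcPmf n k) * (h 0 + h 1)) / 2 := by
    rw [Finset.sum_mul, ← Finset.sum_add_distrib, ← Finset.sum_sub_distrib, Finset.sum_div]
    exact Finset.sum_congr rfl fun k _ => by rw [symmetrize]; ring
  rw [hsum, hrefl, sum_arcPmf]
  ring

lemma integral_arcDensity_mul_symmetrize {h : ℝ → ℝ} (hh : Continuous h) :
    ∫ x in (0 : ℝ)..1, arcDensity x * symmetrize h x
      = (∫ x in (0 : ℝ)..1, arcDensity x * h x) - (h 0 + h 1) / 2 := by
  have hrefl : ∫ x in (0 : ℝ)..1, arcDensity x * h (1 - x)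
      = ∫ x in (0 : ℝ)..1, arcDensity x * h x := by
    have := intervalIntegral.integral_comp_sub_left (a := 0) (b := 1)
      (fun x => arcDensity x * h x) 1
    simpa only [arcDensity_one_sub, sub_self, sub_zero] using this
  have hi1 := intervalIntegrable_arcDensity_mul hh 0 1
  have hi2 := intervalIntegrable_arcDensity_mul (g := fun x => h (1 - x)) (by fun_prop) 0 1
  have hi3 := (integrable_arcDensity.intervalIntegrable (a := 0) (b := 1)).mul_const (h 0 + h 1)
  have hsum : ∫ x in (0 : ℝ)..1, arcDensity x * symmetrize h x
      = ((∫ x in (0 : ℝ)..1, arcDensity x * h x) + (∫ x in (0 : ℝ)..1, arcDensity x * h (1 - x))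
          - (∫ x in (0 : ℝ)..1, arcDensity x) * (h 0 + h 1)) / 2 := by
    rw [← intervalIntegral.integral_mul_const, ← intervalIntegral.integral_add hi1 hi2,
      ← intervalIntegral.integral_sub (hi1.add hi2) hi3, ← intervalIntegral.integral_div]
    refine intervalIntegral.integral_congr fun x _ => ?_
    simp only [symmetrize]
    ring
  rw [hsum, hrefl, integral_arcDensity]
  ring

/-- With `K` distributed as `L_{2n}/2` (so that `K/n` is
distributed as `L_{2n}/(2n)`) and `Z` Arcsine distributed,
`d_W(K/n, Z) ≤ 27/(2n) + 8/n²`, stated as: the bound holds for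
`|E h(K/n) - E h(Z)|` for every `1`-Lipschitz `h`. -/
theorem stmt_18 (n : ℕ) (hn : 1 ≤ n) (h : ℝ → ℝ) (hLip : LipschitzWith 1 h) :
    |∑ k ∈ Finset.range (n + 1), arcPmf n k * h ((k : ℝ) / n)
        - betaExp (1 / 2) (1 / 2) h|
      ≤ 27 / (2 * (n : ℝ)) + 8 / (n : ℝ) ^ 2 := by
  have hn' : (0 : ℝ) < n := by exact_mod_cast hn
  have hg := lipschitzWith_symmetrize hLip
  have hdiff : ∑ k ∈ Finset.range (n + 1), arcPmf n k * h ((k : ℝ) / n)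
        - betaExp (1 / 2) (1 / 2) h
      = ∑ k ∈ Finset.range (n + 1), ((arcPmf n k - arcCell n k) * symmetrize h ((k : ℝ) / n)
          - ((∫ x in ((k : ℝ) / (n + 1))..(((k + 1 : ℕ) : ℝ) / (n + 1)),
              arcDensity x * symmetrize h x) - arcCell n k * symmetrize h ((k : ℝ) / n))) := by
    have hp := sum_arcPmf_mul_symmetrize hn h
    have hq := integral_arcDensity_mul_symmetrize hLip.continuous
    rw [← sum_cell_integral hg.continuous n] at hq
    rw [betaExp_half_half, ← sub_sub_sub_cancel_right _ _ ((h 0 + h 1) / 2), ← hp, ← hq,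
      ← Finset.sum_sub_distrib]
    exact Finset.sum_congr rfl fun k _ => by ring
  rw [hdiff]
  calc _ ≤ ∑ k ∈ Finset.range (n + 1),
          (((n : ℝ) + 1) / n ^ 2 * arcPmf n k + 1 / n * arcCell n k) := by
        refine (Finset.abs_sum_le_sum_abs _ _).trans (Finset.sum_le_sum fun k hk => ?_)
        have hkn : k ≤ n := by simpa [Nat.lt_succ_iff] using hk
        have hkn' : (k : ℝ) / n ≤ 1 := (div_le_one hn').2 (by exact_mod_cast hkn)
        obtain ⟨hc₀, hc₁⟩ := abs_symmetrize_le hLip (by positivity) hkn'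
        refine (abs_sub _ _).trans (add_le_add ?_ (abs_cell_integral_sub_le hn hkn hg))
        rw [abs_mul]
        exact abs_arcPmf_sub_arcCell_mul_le hkn hc₀ hc₁
    _ = ((n : ℝ) + 1) / n ^ 2 + 1 / n := by
        rw [Finset.sum_add_distrib, ← Finset.mul_sum, ← Finset.mul_sum, sum_arcPmf, sum_arcCell,
          mul_one, mul_one]
    _ ≤ 27 / (2 * (n : ℝ)) + 8 / (n : ℝ) ^ 2 := by
        rw [← sub_nonneg]
        have : 27 / (2 * (n : ℝ)) + 8 / (n : ℝ) ^ 2 - (((n : ℝ) + 1) / n ^ 2 + 1 / n)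
            = 23 / (2 * n) + 7 / n ^ 2 := by
          field_simp
          ring
        rw [this]
        positivity
end
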